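/- Let d ≥ 1 and let (q,r) be an admissible pair. There is a constant C = C(d,q,r) > 0 such that for every interval I ⊆ ℝ and every Schwartz function u₀ ∈ 𝒮(ℝ^d), the homogeneous Strichartz estimate ‖e^{itΔ}u₀‖_{L^q_I L^r} ≤ C ‖u₀‖_{L²(ℝ^d)} holds, with the usual modification (essential supremum over I) when q = ∞. -/

import Mathlib

open MeasureTheory Complex Filter
open scoped ENNReal RealInnerProductSpace

noncomputable section

/-- `d`-dimensional Euclidean space. -/
abbrev Ed (d : ℕ) := EuclideanSpace ℝ (Fin d)

/-- Fourier transform: `f̂(ξ) = ∫ e^{-i x·ξ} f(x) dx`. -/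
def FT (d : ℕ) (f : Ed d → ℂ) (ξ : Ed d) : ℂ :=
  ∫ x, Complex.exp (-Complex.I * (⟪x, ξ⟫ : ℝ)) * f x

/-- Inverse Fourier transform: `(F⁻¹ g)(x) = (2π)^{-d} ∫ e^{i x·ξ} g(ξ) dξ`. -/
def FTinv (d : ℕ) (g : Ed d → ℂ) (x : Ed d) : ℂ :=
  (((2 * Real.pi) ^ d : ℝ) : ℂ)⁻¹ * ∫ ξ, Complex.exp (Complex.I * (⟪x, ξ⟫ : ℝ)) * g ξ

/-- Schrödinger propagator `e^{itΔ} f = F⁻¹(e^{-it|ξ|²} f̂(ξ))`. -/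
def schrod (d : ℕ) (t : ℝ) (f : Ed d → ℂ) : Ed d → ℂ :=
  FTinv d fun ξ => Complex.exp (-Complex.I * t * (‖ξ‖ ^ 2 : ℝ)) * FT d f ξ

/-- An admissible (Schrödinger) pair: `2 ≤ q,r ≤ ∞`, `2/q + d/r = d/2`, `(q,r,d) ≠ (2,∞,2)`. -/
def Admissible (d : ℕ) (q r : ℝ≥0∞) : Prop :=
  2 ≤ q ∧ 2 ≤ r ∧ 2 / q + d / r = d / 2 ∧ ¬(q = 2 ∧ r = ∞ ∧ d = 2)

/-- Mixed space-time norm `‖u‖_{L^q_I X} = (∫_I (g t)^q dt)^{1/q}` where `g t = ‖u(t,·)‖_X`,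
with the essential supremum modification when `q = ∞`. -/
def mixedNorm (q : ℝ≥0∞) (I : Set ℝ) (g : ℝ → ℝ≥0∞) : ℝ≥0∞ :=
  if q = ∞ then essSup g (volume.restrict I)
  else (∫⁻ t in I, g t ^ q.toReal) ^ (1 / q.toReal)

/-- Sums of two-sided geometric sequences are bounded independently of their centre. -/
lemma exists_tsum_two_rpow_neg_abs_le {ε : ℝ} (hε : 0 < ε) :
    ∃ C : ℝ≥0∞, C ≠ ∞ ∧ ∀ L : ℝ, ∑' n : ℤ, (2 : ℝ≥0∞) ^ (-ε * |n - L|) ≤ C := by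
  set ρ : ℝ≥0∞ := (2 : ℝ≥0∞) ^ (-ε) with hρ
  have hρ1 : ρ < 1 := ENNReal.rpow_lt_one_of_one_lt_of_neg (by norm_num) (by linarith)
  have hgeo : ∑' n : ℕ, ρ ^ n ≠ ∞ := by
    rw [ENNReal.tsum_geometric]
    exact ENNReal.inv_ne_top.2 (tsub_pos_of_lt hρ1).ne'
  have hsum : ∑' n : ℤ, (2 : ℝ≥0∞) ^ (-ε * |(n : ℝ)|) ≤ ∑' n : ℕ, ρ ^ n + ∑' n : ℕ, ρ ^ n := by
    rw [tsum_of_nat_of_neg_add_one ENNReal.summable ENNReal.summable]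
    refine add_le_add (ENNReal.tsum_le_tsum fun n => ?_) (ENNReal.tsum_le_tsum fun n => ?_)
    · rw [hρ, ← ENNReal.rpow_natCast, ← ENNReal.rpow_mul]
      simp
    · rw [hρ, ← ENNReal.rpow_natCast, ← ENNReal.rpow_mul]
      refine ENNReal.rpow_le_rpow_of_exponent_le (by norm_num) ?_
      have : |((-((n : ℤ) + 1) : ℤ) : ℝ)| = n + 1 := by
        push_cast
        rw [abs_neg, abs_of_nonneg (by positivity)]
      rw [this]
      nlinarith
  refine ⟨(2 : ℝ≥0∞) ^ ε * (∑' n : ℕ, ρ ^ n + ∑' n : ℕ, ρ ^ n),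
    ENNReal.mul_ne_top (ENNReal.rpow_ne_top_of_nonneg hε.le (by norm_num))
      (ENNReal.add_ne_top.2 ⟨hgeo, hgeo⟩), fun L => ?_⟩
  calc ∑' n : ℤ, (2 : ℝ≥0∞) ^ (-ε * |n - L|)
      ≤ ∑' n : ℤ, (2 : ℝ≥0∞) ^ ε * (2 : ℝ≥0∞) ^ (-ε * |((n - ⌊L⌋ : ℤ) : ℝ)|) := by
        refine ENNReal.tsum_le_tsum fun n => ?_
        rw [← ENNReal.rpow_add _ _ (by norm_num) (by norm_num)]
        refine ENNReal.rpow_le_rpow_of_exponent_le (by norm_num) ?_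
        have h1 : |((n - ⌊L⌋ : ℤ) : ℝ)| ≤ |n - L| + 1 := by
          have : ((n - ⌊L⌋ : ℤ) : ℝ) = (n - L) + (L - ⌊L⌋) := by push_cast; ring
          rw [this]
          have h2 : |L - ⌊L⌋| ≤ 1 := by
            rw [abs_le]
            constructor <;> linarith [Int.floor_le L, Int.lt_floor_add_one L]
          exact (abs_add_le _ _).trans (by gcongr)
        nlinarith [h1]
    _ = (2 : ℝ≥0∞) ^ ε * ∑' n : ℤ, (2 : ℝ≥0∞) ^ (-ε * |(n : ℝ)|) := by
        rw [ENNReal.tsum_mul_left]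
        congr 1
        exact (Equiv.subRight ⌊L⌋).tsum_eq (fun n : ℤ => (2 : ℝ≥0∞) ^ (-ε * |(n : ℝ)|))
    _ ≤ _ := by gcongr

/-- The integral of an even function over a symmetric set is controlled by half of it. -/
lemma setLIntegral_abs_le (f : ℝ → ℝ≥0∞) {S : Set ℝ} (hS : MeasurableSet S) :
    ∫⁻ t in {t | |t| ∈ S}, f |t| ≤ 2 * ∫⁻ t in S ∩ Set.Ici 0, f t := by
  have hsub : {t : ℝ | |t| ∈ S} ⊆ (S ∩ Set.Ici 0) ∪ Neg.neg ⁻¹' (S ∩ Set.Ici 0) := by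
    intro t ht
    rcases le_total 0 t with h | h
    · left; exact ⟨by simpa [abs_of_nonneg h] using ht, h⟩
    · right; exact ⟨by simpa [abs_of_nonpos h] using ht, by simpa using h⟩
  have hmp : MeasurePreserving (Neg.neg : ℝ → ℝ) volume volume :=
    Measure.measurePreserving_neg volume
  have hneg : MeasurableEmbedding (Neg.neg : ℝ → ℝ) := (MeasurableEquiv.neg ℝ).measurableEmbedding
  calc ∫⁻ t in {t | |t| ∈ S}, f |t|
      ≤ (∫⁻ t in S ∩ Set.Ici 0, f |t|) + ∫⁻ t in Neg.neg ⁻¹' (S ∩ Set.Ici 0), f |t| :=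
        (lintegral_mono_set hsub).trans (lintegral_union_le _ _ _)
    _ ≤ (∫⁻ t in S ∩ Set.Ici 0, f |t|) + ∫⁻ t in S ∩ Set.Ici 0, f |t| := by
        refine add_le_add le_rfl ?_
        have := hmp.setLIntegral_comp_preimage_emb hneg (fun t => f |t|) (S ∩ Set.Ici 0)
        simp only [abs_neg] at this
        exact this.le
    _ = 2 * ∫⁻ t in S ∩ Set.Ici 0, f |t| := by rw [two_mul]
    _ = _ := by
        congr 1
        exact setLIntegral_congr_fun (hS.inter measurableSet_Ici)
          fun t ht => by rw [abs_of_nonneg (Set.mem_Ici.1 ht.2)]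

/-- Integral of `|t|^{-γ}` near the origin. -/
lemma lintegral_abs_rpow_neg_near {γ ρ : ℝ} (h0 : 0 < γ) (h1 : γ < 1) (hρ : 0 ≤ ρ) :
    ∫⁻ t in {t : ℝ | |t| ≤ ρ}, ENNReal.ofReal |t| ^ (-γ)
      ≤ ENNReal.ofReal (2 / (1 - γ)) * ENNReal.ofReal ρ ^ (1 - γ) := by
  refine (setLIntegral_abs_le (fun t => ENNReal.ofReal t ^ (-γ)) measurableSet_Iic).trans ?_
  have hint : IntegrableOn (fun t : ℝ => t ^ (-γ)) (Set.Ioc 0 ρ) :=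
    ((intervalIntegral.intervalIntegrable_rpow' (by linarith)).1 : _)
  have : ∫⁻ t in Set.Iic ρ ∩ Set.Ici 0, ENNReal.ofReal t ^ (-γ)
      = ENNReal.ofReal (ρ ^ (1 - γ) / (1 - γ)) := by
    have hset : (Set.Iic ρ ∩ Set.Ici 0 : Set ℝ) = Set.Icc 0 ρ := by
      ext; simp [and_comm]
    rw [hset, ← setLIntegral_congr (Ioc_ae_eq_Icc (a := (0:ℝ)) (b := ρ) (μ := volume)),
      setLIntegral_congr_fun measurableSet_Ioc (g := fun t : ℝ => ENNReal.ofReal (t ^ (-γ)))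
        (fun t ht => by simp [ENNReal.ofReal_rpow_of_pos ht.1]),
      ← ofReal_integral_eq_lintegral_ofReal hint
        ((ae_restrict_iff' measurableSet_Ioc).2 (ae_of_all _ fun t ht =>
          Real.rpow_nonneg ht.1.le _)),
      ← intervalIntegral.integral_of_le hρ, integral_rpow (Or.inl (by linarith))]
    rw [Real.zero_rpow (by linarith), sub_zero]
    ring_nf
  rw [this, ENNReal.ofReal_rpow_of_nonneg hρ (by linarith), ← ENNReal.ofReal_mul (by
    apply div_nonneg <;> linarith), show (2 : ℝ≥0∞) = ENNReal.ofReal 2 by simp,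
    ← ENNReal.ofReal_mul (by norm_num)]
  apply le_of_eq; congr 1; ring

/-- Integral of `|t|^{-2}` away from the origin. -/
lemma lintegral_abs_rpow_neg_two_far {ρ : ℝ} (hρ : 0 < ρ) :
    ∫⁻ t in {t : ℝ | ρ < |t|}, ENNReal.ofReal |t| ^ (-2 : ℝ) ≤ 2 * (ENNReal.ofReal ρ)⁻¹ := by
  refine (setLIntegral_abs_le (fun t => ENNReal.ofReal t ^ (-2 : ℝ)) measurableSet_Ioi).trans ?_
  have hset : (Set.Ioi ρ ∩ Set.Ici 0 : Set ℝ) = Set.Ioi ρ := by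
    ext t; simp only [Set.mem_inter_iff, Set.mem_Ioi, Set.mem_Ici]
    exact ⟨fun h => h.1, fun h => ⟨h, by linarith⟩⟩
  rw [hset, setLIntegral_congr_fun measurableSet_Ioi (g := fun t : ℝ => ENNReal.ofReal (t ^ (-2 : ℝ)))
        (fun t ht => by simp [ENNReal.ofReal_rpow_of_pos (hρ.trans ht)]),
      ← ofReal_integral_eq_lintegral_ofReal (integrableOn_Ioi_rpow_of_lt (by norm_num) hρ)
        ((ae_restrict_iff' measurableSet_Ioi).2 (ae_of_all _ fun t ht =>
          Real.rpow_nonneg (hρ.trans ht).le _)),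
      integral_Ioi_rpow_of_lt (by norm_num) hρ, ← ENNReal.ofReal_inv_of_pos hρ]
  gcongr
  norm_num [Real.rpow_neg_one]

lemma ENNReal.mul_le_sq_add_sq (a b : ℝ≥0∞) : a * b ≤ a ^ 2 + b ^ 2 := by
  rcases le_total a b with h | h
  · exact (mul_le_mul_left h b).trans (by rw [sq b]; exact le_add_self)
  · exact (mul_le_mul_right h a).trans (by rw [sq a]; exact le_self_add)

/-- Schur's test for convolution kernels. -/
lemma lintegral_mul_mul_kernel_le {G : Type*} [AddCommGroup G] [MeasurableSpace G]
    [MeasurableAdd₂ G] [MeasurableNeg G] (μ : Measure G) [SFinite μ] [μ.IsAddLeftInvariant]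
    [μ.IsNegInvariant] {f g K : G → ℝ≥0∞} (hf : AEMeasurable f μ) (hg : AEMeasurable g μ)
    (hK : Measurable K) :
    ∫⁻ s, ∫⁻ t, f s * g t * K (s - t) ∂μ ∂μ
      ≤ (∫⁻ z, K z ∂μ) * (∫⁻ s, f s ^ 2 ∂μ + ∫⁻ s, g s ^ 2 ∂μ) := by
  have hKm : Measurable fun z : G × G => K (z.1 - z.2) := hK.comp (measurable_fst.sub measurable_snd)
  have hKs : ∀ s, Measurable fun t => K (s - t) := fun s => hKm.comp measurable_prodMk_left
  have hleft : ∀ (c : ℝ≥0∞) s, ∫⁻ t, c * K (s - t) ∂μ = c * ∫⁻ z, K z ∂μ := fun c s => by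
    rw [lintegral_const_mul _ (hKs s), lintegral_sub_left_eq_self K s]
  have hright : ∀ (c : ℝ≥0∞) t, ∫⁻ s, c * K (s - t) ∂μ = c * ∫⁻ z, K z ∂μ := fun c t => by
    have hKt : Measurable fun s => K (s - t) := hK.comp (measurable_id.sub_const t)
    rw [lintegral_const_mul _ hKt, lintegral_sub_right_eq_self K t]
  calc ∫⁻ s, ∫⁻ t, f s * g t * K (s - t) ∂μ ∂μ
      ≤ ∫⁻ s, ∫⁻ t, f s ^ 2 * K (s - t) + g t ^ 2 * K (s - t) ∂μ ∂μ := by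
        gcongr with s t
        rw [← add_mul]
        gcongr
        exact ENNReal.mul_le_sq_add_sq _ _
    _ = ∫⁻ s, ((∫⁻ t, f s ^ 2 * K (s - t) ∂μ) + ∫⁻ t, g t ^ 2 * K (s - t) ∂μ) ∂μ := by
        congr with s
        exact lintegral_add_left ((hKs s).const_mul _) _
    _ = (∫⁻ s, ∫⁻ t, f s ^ 2 * K (s - t) ∂μ ∂μ) + ∫⁻ s, ∫⁻ t, g t ^ 2 * K (s - t) ∂μ ∂μ := by
        refine lintegral_add_left' ?_ _
        simp_rw [hleft]
        exact (hf.pow_const 2).mul_const _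
    _ = _ := by
        have hswap : ∫⁻ s, ∫⁻ t, g t ^ 2 * K (s - t) ∂μ ∂μ = ∫⁻ t, ∫⁻ s, g t ^ 2 * K (s - t) ∂μ ∂μ :=
          lintegral_lintegral_swap ((hg.pow_const 2).comp_snd.mul hKm.aemeasurable)
        rw [hswap]
        simp_rw [hleft, hright]
        rw [lintegral_mul_const'' _ (hf.pow_const 2), lintegral_mul_const'' _ (hg.pow_const 2)]
        ring

lemma hardy_littlewood_sobolev_pointwise {γ : ℝ} (h0 : 0 < γ) (h1 : γ < 1) {f : ℝ → ℝ≥0∞}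
    (hf : Measurable f) (s : ℝ) (hs0 : f s ≠ 0) (hs : f s ≠ ∞) {p : ℝ} (hp : p = 2 / (2 - γ))
    {Q : ℝ≥0∞} (hQ : Q = ∫⁻ t, f t ^ p) (hQ0 : Q ≠ 0) (hQt : Q ≠ ∞) :
    ∫⁻ t in {t | f t ≤ f s}, f t * ENNReal.ofReal |s - t| ^ (-γ)
      ≤ (ENNReal.ofReal (2 / (1 - γ)) + 2) * (f s ^ (p - 1) * Q ^ (1 - γ)) := by
  set a := f s with ha
  have hp0 : 0 < p := by rw [hp]; apply div_pos <;> linarith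
  set R : ℝ≥0∞ := Q * a ^ (-p) with hR
  have hR0 : R ≠ 0 := mul_ne_zero hQ0 (by simp [ENNReal.rpow_eq_zero_iff, hs0, hs])
  have hRt : R ≠ ∞ := ENNReal.mul_ne_top hQt (by simp [ENNReal.rpow_eq_top_iff, hs0, hs])
  set ρ := R.toReal with hρ
  have hρ0 : 0 < ρ := ENNReal.toReal_pos hR0 hRt
  have hρR : ENNReal.ofReal ρ = R := ENNReal.ofReal_toReal hRt
  have hKm : Measurable fun t : ℝ => ENNReal.ofReal |s - t| ^ (-γ) := by fun_prop
  have e1 : p * (2 - γ) = 2 := by rw [hp]; field_simp [show (2 - γ) ≠ 0 by linarith]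
  have near : ∫⁻ t in {t | f t ≤ a} ∩ {t | |s - t| ≤ ρ}, f t * ENNReal.ofReal |s - t| ^ (-γ)
      ≤ ENNReal.ofReal (2 / (1 - γ)) * (a ^ (p - 1) * Q ^ (1 - γ)) := by
    calc _ ≤ ∫⁻ t in {t | f t ≤ a} ∩ {t | |s - t| ≤ ρ}, a * ENNReal.ofReal |s - t| ^ (-γ) := by
          refine setLIntegral_mono' ((measurableSet_le hf measurable_const).inter
            (measurableSet_le (by fun_prop) measurable_const)) fun t ht => ?_
          gcongr
          exact ht.1
      _ ≤ ∫⁻ t in {t | |s - t| ≤ ρ}, a * ENNReal.ofReal |s - t| ^ (-γ) :=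
          lintegral_mono_set Set.inter_subset_right
      _ = a * ∫⁻ t in {t | |t| ≤ ρ}, ENNReal.ofReal |t| ^ (-γ) := by
          rw [lintegral_const_mul _ hKm]
          congr 1
          rw [← lintegral_indicator (measurableSet_le (by fun_prop) measurable_const),
            ← lintegral_indicator (measurableSet_le (by fun_prop) measurable_const)]
          exact lintegral_sub_left_eq_self
            ({t : ℝ | |t| ≤ ρ}.indicator fun t => ENNReal.ofReal |t| ^ (-γ)) s
      _ ≤ a * (ENNReal.ofReal (2 / (1 - γ)) * R ^ (1 - γ)) := by
          rw [← hρR]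
          gcongr
          exact lintegral_abs_rpow_neg_near h0 h1 hρ0.le
      _ = ENNReal.ofReal (2 / (1 - γ)) * (a ^ (p - 1) * Q ^ (1 - γ)) := by
          rw [hR, ENNReal.mul_rpow_of_nonneg _ _ (by linarith), ← ENNReal.rpow_mul]
          rw [show p - 1 = 1 + -p * (1 - γ) by linarith, ENNReal.rpow_add _ _ hs0 hs,
            ENNReal.rpow_one]
          ring
  have far : ∫⁻ t in {t | ρ < |s - t|}, f t * ENNReal.ofReal |s - t| ^ (-γ)
      ≤ 2 * (a ^ (p - 1) * Q ^ (1 - γ)) := by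
    have hpq : p.HolderConjugate (2 / γ) := by
      rw [Real.holderConjugate_iff]
      refine ⟨by rw [hp, lt_div_iff₀] <;> linarith, ?_⟩
      rw [hp]
      field_simp
      ring
    calc _ ≤ (∫⁻ t in {t | ρ < |s - t|}, f t ^ p) ^ (1 / p)
          * (∫⁻ t in {t | ρ < |s - t|}, (ENNReal.ofReal |s - t| ^ (-γ)) ^ (2 / γ)) ^ (1 / (2 / γ)) :=
          ENNReal.lintegral_mul_le_Lp_mul_Lq _ hpq hf.aemeasurable hKm.aemeasurable
      _ ≤ Q ^ (1 / p) * (2 * R⁻¹) ^ (1 / (2 / γ)) := by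
          gcongr
          · rw [hQ]; exact setLIntegral_le_lintegral _ _
          · have := lintegral_abs_rpow_neg_two_far hρ0
            rw [hρR] at this
            refine le_trans (le_of_eq ?_) this
            simp_rw [← ENNReal.rpow_mul, show -γ * (2 / γ) = -2 by field_simp]
            rw [← lintegral_indicator (measurableSet_lt measurable_const (by fun_prop)),
              ← lintegral_indicator (measurableSet_lt measurable_const (by fun_prop))]
            exact lintegral_sub_left_eq_self
              ({t : ℝ | ρ < |t|}.indicator fun t => ENNReal.ofReal |t| ^ (-2 : ℝ)) s
      _ ≤ Q ^ (1 / p) * (2 * (R⁻¹) ^ (γ / 2)) := by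
          rw [show 1 / (2 / γ) = γ / 2 by field_simp,
            ENNReal.mul_rpow_of_nonneg _ _ (by linarith)]
          gcongr
          conv_rhs => rw [← ENNReal.rpow_one 2]
          exact ENNReal.rpow_le_rpow_of_exponent_le (by norm_num) (by linarith)
      _ = 2 * (a ^ (p - 1) * Q ^ (1 - γ)) := by
          rw [hR, ENNReal.mul_inv (Or.inl hQ0) (Or.inl hQt),
            ENNReal.mul_rpow_of_nonneg _ _ (by linarith), ← ENNReal.rpow_neg_one,
            ← ENNReal.rpow_neg_one, ← ENNReal.rpow_mul, ← ENNReal.rpow_mul, ← ENNReal.rpow_mul,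
            show 1 - γ = 1 / p + -1 * (γ / 2) by rw [hp]; field_simp; ring,
            ENNReal.rpow_add _ _ hQ0 hQt, show p - 1 = -p * -1 * (γ / 2) by linarith]
          ring_nf
  calc _ ≤ ∫⁻ t in ({t | f t ≤ a} ∩ {t | |s - t| ≤ ρ}) ∪ {t | ρ < |s - t|},
        f t * ENNReal.ofReal |s - t| ^ (-γ) := by
        refine lintegral_mono_set fun t ht => ?_
        rcases le_or_gt |s - t| ρ with h | h
        · exact Or.inl ⟨ht, h⟩
        · exact Or.inr h
    _ ≤ _ := lintegral_union_le _ _ _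
    _ ≤ _ := by rw [add_mul]; exact add_le_add near far

/-- The diagonal one-dimensional Hardy-Littlewood-Sobolev inequality. -/
lemma hardy_littlewood_sobolev {γ : ℝ} (h0 : 0 < γ) (h1 : γ < 1) {p : ℝ} (hp : p = 2 / (2 - γ))
    {f : ℝ → ℝ≥0∞} (hf : Measurable f) :
    ∫⁻ s, ∫⁻ t, f s * f t * ENNReal.ofReal |s - t| ^ (-γ)
      ≤ 2 * (ENNReal.ofReal (2 / (1 - γ)) + 2) * (∫⁻ t, f t ^ p) ^ (2 / p) := by
  have hp0 : 0 < p := by rw [hp]; apply div_pos <;> linarith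
  have e1 : p * (2 - γ) = 2 := by rw [hp]; field_simp [show (2 - γ) ≠ 0 by linarith]
  set Q := ∫⁻ t, f t ^ p with hQ
  rcases eq_or_ne Q ∞ with hQt | hQt
  · rw [hQt, ENNReal.top_rpow_of_pos (by positivity), ENNReal.mul_top (by positivity)]
    exact le_top
  rcases eq_or_ne Q 0 with hQ0 | hQ0
  · have : ∀ᵐ t, f t = 0 := by
      filter_upwards [(lintegral_eq_zero_iff (hf.pow_const p)).1 hQ0] with t ht
      simpa [ENNReal.rpow_eq_zero_iff, hp0, hp0.le.not_gt] using ht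
    refine le_trans (le_of_eq ?_) zero_le
    rw [lintegral_eq_zero_iff' (by fun_prop)]
    filter_upwards [this] with s hs
    simp [hs]
  have hfin : ∀ᵐ t, f t < ∞ := by
    filter_upwards [ae_lt_top (hf.pow_const p) hQt] with t ht
    by_contra h
    simp [not_lt_top_iff.1 h, hp0] at ht
  set S : Set (ℝ × ℝ) := {z | f z.2 ≤ f z.1} with hS
  set B : ℝ × ℝ → ℝ≥0∞ := fun z => f z.1 * f z.2 * ENNReal.ofReal |z.1 - z.2| ^ (-γ) with hB
  have hBm : Measurable B := by fun_prop
  have hSm : MeasurableSet S := measurableSet_le (by fun_prop) (by fun_prop)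
  have half : ∫⁻ s, ∫⁻ t, S.indicator B (s, t)
      ≤ (ENNReal.ofReal (2 / (1 - γ)) + 2) * Q ^ (2 / p) := by
    calc _ ≤ ∫⁻ s, (ENNReal.ofReal (2 / (1 - γ)) + 2) * (f s ^ p * Q ^ (1 - γ)) := by
          refine lintegral_mono_ae ?_
          filter_upwards [hfin] with s hs
          rcases eq_or_ne (f s) 0 with hs0 | hs0
          · refine le_trans (le_of_eq ?_) zero_le
            simp [hB, hs0, Set.indicator]
          have key := hardy_littlewood_sobolev_pointwise h0 h1 hf s hs0 hs.ne hp hQ hQ0 hQt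
          calc _ = f s * ∫⁻ t in {t | f t ≤ f s}, f t * ENNReal.ofReal |s - t| ^ (-γ) := by
                rw [← lintegral_const_mul _ (by fun_prop), ← lintegral_indicator
                  (measurableSet_le hf measurable_const)]
                congr with t
                simp only [hS, hB, Set.indicator, Set.mem_ofPred_eq]
                split_ifs <;> ring
            _ ≤ f s * ((ENNReal.ofReal (2 / (1 - γ)) + 2) * (f s ^ (p - 1) * Q ^ (1 - γ))) := by
                gcongr
            _ = _ := by
                have : f s ^ p = f s * f s ^ (p - 1) := by
                  conv_rhs => lhs; rw [← ENNReal.rpow_one (f s)]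
                  rw [← ENNReal.rpow_add _ _ hs0 hs.ne, add_sub_cancel]
                rw [this]
                ring
      _ = (ENNReal.ofReal (2 / (1 - γ)) + 2) * (Q * Q ^ (1 - γ)) := by
          rw [lintegral_const_mul _ (by fun_prop), lintegral_mul_const _ (by fun_prop)]
      _ = _ := by
          congr 1
          conv_lhs => rw [← ENNReal.rpow_one Q, ← ENNReal.rpow_mul, one_mul,
            ← ENNReal.rpow_add _ _ hQ0 hQt]
          congr 1
          field_simp
          linarith
  calc ∫⁻ s, ∫⁻ t, f s * f t * ENNReal.ofReal |s - t| ^ (-γ)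
      ≤ ∫⁻ s, ∫⁻ t, (S.indicator B (s, t) + S.indicator B (t, s)) := by
        gcongr with s t
        rcases le_total (f t) (f s) with h | h
        · refine le_trans (le_of_eq ?_) le_self_add
          simp [hS, hB, Set.indicator, h]
        · refine le_trans (le_of_eq ?_) le_add_self
          simp only [hS, hB, Set.indicator, h, Set.mem_ofPred_eq, if_true]
          rw [mul_comm (f s), abs_sub_comm]
    _ = (∫⁻ s, ∫⁻ t, S.indicator B (s, t)) + ∫⁻ s, ∫⁻ t, S.indicator B (t, s) := by
        have hm := hBm.indicator hSm
        rw [← lintegral_add_left (by fun_prop)]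
        congr with s
        exact lintegral_add_left (by fun_prop) _
    _ = (∫⁻ s, ∫⁻ t, S.indicator B (s, t)) + ∫⁻ s, ∫⁻ t, S.indicator B (s, t) := by
        congr 1
        exact lintegral_lintegral_swap (f := fun s t => S.indicator B (t, s))
          ((hBm.indicator hSm).comp measurable_swap).aemeasurable
    _ ≤ _ := by rw [mul_assoc, two_mul]; gcongr

section Layers

variable {X : Type*} [MeasurableSpace X]

/-- Measure of the superlevel set of `a` through the point `x`. -/
def superMass (ν : Measure X) (a : X → ℝ≥0∞) (x : X) : ℝ≥0∞ := ν {y | a x ≤ a y}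

/-- The points at which the superlevel set of `a` has measure comparable to `2 ^ n`. -/
def massLayer (ν : Measure X) (a : X → ℝ≥0∞) (n : ℤ) : Set X :=
  {x | (2 : ℝ≥0∞) ^ ((n : ℝ) - 1) < superMass ν a x ∧ superMass ν a x ≤ (2 : ℝ≥0∞) ^ (n : ℝ)}

/-- The size in `L ^ p` of `a` near its `n`-th layer. -/
def layerNorm (ν : Measure X) (p : ℝ) (a : X → ℝ≥0∞) (n : ℤ) : ℝ≥0∞ :=
  ((∫⁻ x in massLayer ν a n, a x ^ p ∂ν) + ∫⁻ x in massLayer ν a (n - 1), a x ^ p ∂ν) ^ (1 / p)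

variable {ν : Measure X} {a : X → ℝ≥0∞}

lemma measurable_superMass (ha : Measurable a) : Measurable (superMass ν a) := by
  have h : Antitone fun l : ℝ≥0∞ => ν {y | l ≤ a y} :=
    fun l m hlm => measure_mono fun y hy => hlm.trans hy
  exact h.measurable.comp ha

lemma measurableSet_massLayer (ha : Measurable a) (n : ℤ) : MeasurableSet (massLayer ν a n) :=
  (measurableSet_lt measurable_const (measurable_superMass ha)).inter
    (measurableSet_le (measurable_superMass ha) measurable_const)

lemma measure_superMass_le (c : ℝ≥0∞) : ν {x | superMass ν a x ≤ c} ≤ c := by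
  set S := {x | superMass ν a x ≤ c}
  rcases S.eq_empty_or_nonempty with hS | hS
  · simp [hS]
  obtain ⟨u, hu, hlim, humem⟩ := exists_seq_tendsto_sInf (hS.image a) (OrderBot.bddBelow _)
  choose y hyS hy using humem
  by_cases hatt : sInf (a '' S) ∈ a '' S
  · obtain ⟨x, hx, hax⟩ := hatt
    refine (measure_mono fun z hz => ?_).trans (show ν {y | a x ≤ a y} ≤ c from hx)
    simp only [Set.mem_ofPred_eq, hax]
    exact sInf_le (Set.mem_image_of_mem a hz)
  · have hsub : S ⊆ ⋃ i, {z | a (y i) ≤ a z} := by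
      intro z hz
      have hlt : sInf (a '' S) < a z :=
        lt_of_le_of_ne (sInf_le (Set.mem_image_of_mem a hz))
          fun h => hatt (h ▸ Set.mem_image_of_mem a hz)
      obtain ⟨i, hi⟩ := (hlim.eventually (gt_mem_nhds hlt)).exists
      exact Set.mem_iUnion.2 ⟨i, by simp only [Set.mem_ofPred_eq, hy]; exact hi.le⟩
    refine (measure_mono hsub).trans ?_
    have hmono : Monotone fun i => {z | a (y i) ≤ a z} := fun i j hij z hz => by
      simp only [Set.mem_ofPred_eq, hy] at hz ⊢
      exact (hu hij).trans hz
    rw [hmono.measure_iUnion]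
    exact iSup_le fun i => hyS i

lemma two_rpow_mul_le_lintegral_massLayer (ha : Measurable a) {p : ℝ} (hp : 0 ≤ p) {n : ℤ} {x : X}
    (hx : x ∈ massLayer ν a n) :
    (2 : ℝ≥0∞) ^ ((n : ℝ) - 2) * a x ^ p
      ≤ (∫⁻ x in massLayer ν a n, a x ^ p ∂ν) + ∫⁻ x in massLayer ν a (n - 1), a x ^ p ∂ν := by
  set Y := {y | a x ≤ a y}
  set Z := {y | superMass ν a y ≤ (2 : ℝ≥0∞) ^ ((n : ℝ) - 2)}
  have hYm : MeasurableSet Y := measurableSet_le measurable_const ha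
  have hZm : MeasurableSet Z := measurableSet_le (measurable_superMass ha) measurable_const
  have htwo : (2 : ℝ≥0∞) ^ ((n : ℝ) - 1) = 2 ^ ((n : ℝ) - 2) + 2 ^ ((n : ℝ) - 2) := by
    rw [show (n : ℝ) - 1 = (n - 2) + 1 by ring, ENNReal.rpow_add _ _ (by norm_num) (by norm_num),
      ENNReal.rpow_one, mul_two]
  have hmass : (2 : ℝ≥0∞) ^ ((n : ℝ) - 2) ≤ ν (Y \ Z) := by
    have h1 : (2 : ℝ≥0∞) ^ ((n : ℝ) - 1) ≤ ν (Y \ Z) + 2 ^ ((n : ℝ) - 2) :=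
      calc _ ≤ ν Y := hx.1.le
        _ ≤ ν ((Y \ Z) ∪ Z) := measure_mono (by rw [Set.sdiff_union_self]; exact Set.subset_union_left)
        _ ≤ ν (Y \ Z) + ν Z := measure_union_le _ _
        _ ≤ _ := by gcongr; exact measure_superMass_le _
    rw [htwo] at h1
    exact (ENNReal.add_le_add_iff_right (by simp [ENNReal.rpow_eq_top_iff])).1 h1
  have hsub : Y \ Z ⊆ massLayer ν a n ∪ massLayer ν a (n - 1) := by
    rintro y ⟨hy, hyZ⟩
    have h1 : superMass ν a y ≤ 2 ^ (n : ℝ) :=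
      (measure_mono fun z hz => le_trans (show a x ≤ a y from hy) hz).trans hx.2
    have h2 : (2 : ℝ≥0∞) ^ ((n : ℝ) - 2) < superMass ν a y := not_le.1 hyZ
    rcases le_or_gt (superMass ν a y) (2 ^ ((n : ℝ) - 1)) with h | h
    · right
      refine ⟨?_, ?_⟩
      · rwa [Int.cast_sub, Int.cast_one, sub_sub, one_add_one_eq_two]
      · rwa [Int.cast_sub, Int.cast_one]
    · exact Or.inl ⟨h, h1⟩
  calc _ ≤ ν (Y \ Z) * a x ^ p := by gcongr
    _ = ∫⁻ _ in Y \ Z, a x ^ p ∂ν := by rw [setLIntegral_const, mul_comm]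
    _ ≤ ∫⁻ y in Y \ Z, a y ^ p ∂ν :=
        setLIntegral_mono' (hYm.diff hZm) fun y hy => ENNReal.rpow_le_rpow hy.1 hp
    _ ≤ _ := (lintegral_mono_set hsub).trans (lintegral_union_le _ _ _)

lemma le_layerNorm (ha : Measurable a) {p : ℝ} (hp : 1 ≤ p) {n : ℤ} {x : X}
    (hx : x ∈ massLayer ν a n) : a x ≤ 4 * 2 ^ (-(n : ℝ) / p) * layerNorm ν p a n := by
  have hp0 : 0 < p := by linarith
  have h := ENNReal.rpow_le_rpow (two_rpow_mul_le_lintegral_massLayer ha hp0.le hx)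
    (show 0 ≤ 1 / p by positivity)
  rw [ENNReal.mul_rpow_of_nonneg _ _ (by positivity), ← ENNReal.rpow_mul, ← ENNReal.rpow_mul,
    mul_one_div_cancel hp0.ne', ENNReal.rpow_one] at h
  have h4 : (2 : ℝ≥0∞) ^ (2 / p) ≤ 4 := by
    calc (2 : ℝ≥0∞) ^ (2 / p) ≤ 2 ^ (2 : ℝ) :=
          ENNReal.rpow_le_rpow_of_exponent_le (by norm_num) (by rw [div_le_iff₀ hp0]; linarith)
      _ = 4 := by norm_num
  calc a x = 2 ^ (2 / p) * 2 ^ (-(n : ℝ) / p) * (2 ^ (((n : ℝ) - 2) * (1 / p)) * a x) := by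
        rw [← mul_assoc, ← ENNReal.rpow_add _ _ (by norm_num) (by norm_num),
          ← ENNReal.rpow_add _ _ (by norm_num) (by norm_num)]
        rw [show 2 / p + -(n : ℝ) / p + (n - 2) * (1 / p) = 0 by ring]
        simp
    _ ≤ _ := by gcongr; exact h

lemma measure_massLayer_le (n : ℤ) : ν (massLayer ν a n) ≤ 2 ^ (n : ℝ) :=
  (measure_mono fun _ hx => hx.2).trans (measure_superMass_le _)

lemma lintegral_massLayer_le (ha : Measurable a) {p : ℝ} (hp : 1 ≤ p) (n : ℤ) :
    ∫⁻ x in massLayer ν a n, a x ∂ν ≤ 4 * 2 ^ ((1 - 1 / p) * n) * layerNorm ν p a n := by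
  calc _ ≤ ∫⁻ x in massLayer ν a n, 4 * 2 ^ (-(n : ℝ) / p) * layerNorm ν p a n ∂ν :=
        setLIntegral_mono' (measurableSet_massLayer ha n) fun x hx => le_layerNorm ha hp hx
    _ ≤ 4 * 2 ^ (-(n : ℝ) / p) * layerNorm ν p a n * 2 ^ (n : ℝ) := by
        rw [setLIntegral_const]; gcongr; exact measure_massLayer_le n
    _ = _ := by
        rw [show (1 - 1 / p) * n = -(n : ℝ) / p + n by ring,
          ENNReal.rpow_add _ _ (by norm_num) (by norm_num)]
        ring

lemma lintegral_sq_massLayer_le (ha : Measurable a) {p : ℝ} (hp : 1 ≤ p) (n : ℤ) :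
    ∫⁻ x in massLayer ν a n, a x ^ 2 ∂ν ≤ (4 * 2 ^ ((1 / 2 - 1 / p) * n) * layerNorm ν p a n) ^ 2 := by
  calc _ ≤ ∫⁻ x in massLayer ν a n, (4 * 2 ^ (-(n : ℝ) / p) * layerNorm ν p a n) ^ 2 ∂ν :=
        setLIntegral_mono' (measurableSet_massLayer ha n) fun x hx => by
          gcongr; exact le_layerNorm ha hp hx
    _ ≤ (4 * 2 ^ (-(n : ℝ) / p) * layerNorm ν p a n) ^ 2 * 2 ^ (n : ℝ) := by
        rw [setLIntegral_const]; gcongr; exact measure_massLayer_le n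
    _ = _ := by
        have : (2 : ℝ≥0∞) ^ (n : ℝ) = (2 ^ ((1 / 2 : ℝ) * n)) ^ 2 := by
          rw [← ENNReal.rpow_natCast, ← ENNReal.rpow_mul]; congr 1; push_cast; ring
        rw [this, show (1 / 2 - 1 / p) * n = -(n : ℝ) / p + (1 / 2 : ℝ) * n by ring,
          ENNReal.rpow_add _ _ (by norm_num) (by norm_num)]
        ring

lemma ENNReal.tsum_rpow_le_rpow_tsum {ι : Type*} (f : ι → ℝ≥0∞) {q : ℝ} (hq : 1 ≤ q) :
    ∑' i, f i ^ q ≤ (∑' i, f i) ^ q := by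
  have h : ∀ x : ℝ≥0∞, x ^ q = x * x ^ (q - 1) := fun x => by
    conv_rhs => lhs; rw [← ENNReal.rpow_one x]
    rw [← ENNReal.rpow_add_of_nonneg _ _ zero_le_one (by linarith), add_sub_cancel]
  calc ∑' i, f i ^ q ≤ ∑' i, f i * (∑' i, f i) ^ (q - 1) := by
        refine ENNReal.tsum_le_tsum fun i => ?_
        rw [h]
        gcongr
        exact ENNReal.le_tsum i
    _ = _ := by rw [ENNReal.tsum_mul_right, ← h]

lemma disjoint_massLayer : Pairwise (Function.onFun Disjoint (massLayer ν a)) := by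
  have key : ∀ m n : ℤ, m < n → Disjoint (massLayer ν a m) (massLayer ν a n) := by
    intro m n hmn
    refine Set.disjoint_left.2 fun x hm hn => ?_
    refine absurd (hn.1.trans_le hm.2) (not_lt.2 ?_)
    refine ENNReal.rpow_le_rpow_of_exponent_le (by norm_num) ?_
    have : (m : ℝ) + 1 ≤ n := by exact_mod_cast hmn
    linarith
  intro m n hmn
  rcases lt_or_gt_of_ne hmn with h | h
  · exact key m n h
  · exact (key n m h).symm

lemma tsum_layerNorm_sq_le (ha : Measurable a) {p : ℝ} (hp : 1 ≤ p) (hp2 : p ≤ 2) :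
    ∑' n, layerNorm ν p a n ^ 2 ≤ 4 * (∫⁻ x, a x ^ p ∂ν) ^ (2 / p) := by
  have hp0 : 0 < p := by linarith
  have hsum : ∑' n, ∫⁻ x in massLayer ν a n, a x ^ p ∂ν ≤ ∫⁻ x, a x ^ p ∂ν := by
    rw [← lintegral_iUnion (fun n => measurableSet_massLayer ha n) disjoint_massLayer]
    exact setLIntegral_le_lintegral _ _
  have hsum' : ∑' n : ℤ, ∫⁻ x in massLayer ν a (n - 1), a x ^ p ∂ν ≤ ∫⁻ x, a x ^ p ∂ν :=
    ((Equiv.subRight (1 : ℤ)).tsum_eq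
      fun n => ∫⁻ x in massLayer ν a n, a x ^ p ∂ν).le.trans hsum
  have hq : 1 ≤ 2 / p := by rw [le_div_iff₀ hp0]; linarith
  have hsq : ∀ n, layerNorm ν p a n ^ 2 = ((∫⁻ x in massLayer ν a n, a x ^ p ∂ν)
      + ∫⁻ x in massLayer ν a (n - 1), a x ^ p ∂ν) ^ (2 / p) := fun n => by
    rw [layerNorm, ← ENNReal.rpow_natCast, ← ENNReal.rpow_mul]
    congr 1; push_cast; ring
  simp_rw [hsq]
  refine (ENNReal.tsum_rpow_le_rpow_tsum _ hq).trans ?_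
  rw [ENNReal.tsum_add]
  calc _ ≤ (2 * ∫⁻ x, a x ^ p ∂ν) ^ (2 / p) := by
        rw [two_mul]; gcongr
    _ ≤ _ := by
        rw [ENNReal.mul_rpow_of_nonneg _ _ (by positivity)]
        gcongr
        calc (2 : ℝ≥0∞) ^ (2 / p) ≤ 2 ^ (2 : ℝ) :=
            ENNReal.rpow_le_rpow_of_exponent_le (by norm_num) (by rw [div_le_iff₀ hp0]; linarith)
          _ = 4 := by norm_num

end Layers

section Inner

variable {H : Type*} [NormedAddCommGroup H] [InnerProductSpace ℂ H]

lemma enorm_inner_comm (x y : H) : ‖inner ℂ x y‖ₑ = ‖inner ℂ y x‖ₑ := by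
  rw [← inner_conj_symm, ← ofReal_norm, ← ofReal_norm, RCLike.norm_conj]

lemma enorm_inner_le_enorm (x y : H) : ‖inner ℂ x y‖ₑ ≤ ‖x‖ₑ * ‖y‖ₑ := by
  rw [← ofReal_norm, ← ofReal_norm, ← ofReal_norm,
    ← ENNReal.ofReal_mul (norm_nonneg _)]
  exact ENNReal.ofReal_le_ofReal (norm_inner_le_norm x y)

lemma enorm_inner_self (x : H) : ‖inner ℂ x x‖ₑ = ‖x‖ₑ ^ 2 := by
  rw [← ofReal_norm, ← ofReal_norm, ← ENNReal.ofReal_pow (norm_nonneg _),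
    inner_self_eq_norm_sq_to_K, norm_pow]
  simp

lemma enorm_inner_integral_right_le [CompleteSpace H] {Y : Type*} [MeasurableSpace Y]
    (μ : Measure Y) (h : H) (g : Y → H) :
    ‖inner ℂ h (∫ y, g y ∂μ)‖ₑ ≤ ∫⁻ y, ‖inner ℂ h (g y)‖ₑ ∂μ := by
  by_cases hg : Integrable g μ
  · rw [← integral_inner hg]
    exact enorm_integral_le_lintegral_enorm _
  · simp [integral_undef hg]

lemma enorm_inner_integral_le [CompleteSpace H] {Y Z : Type*} [MeasurableSpace Y]
    [MeasurableSpace Z] (μ : Measure Y) (κ : Measure Z) (f : Y → H) (g : Z → H) :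
    ‖inner ℂ (∫ y, f y ∂μ) (∫ z, g z ∂κ)‖ₑ ≤ ∫⁻ y, ∫⁻ z, ‖inner ℂ (f y) (g z)‖ₑ ∂κ ∂μ := by
  rw [enorm_inner_comm]
  refine (enorm_inner_integral_right_le μ _ f).trans (lintegral_mono fun y => ?_)
  rw [enorm_inner_comm]
  exact enorm_inner_integral_right_le κ _ g

lemma enorm_inner_le_tsum {ι : Type*} {f : ι → H} {S : H} (hf : HasSum f S) (h : H) :
    ‖inner ℂ h S‖ₑ ≤ ∑' i, ‖inner ℂ h (f i)‖ₑ := by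
  have h1 : HasSum (fun i => inner ℂ h (f i)) (inner ℂ h S) := hf.mapL (innerSL ℂ h)
  have h2 : Tendsto (fun s : Finset ι => ‖∑ i ∈ s, inner ℂ h (f i)‖ₑ) atTop (nhds ‖inner ℂ h S‖ₑ) :=
    (continuous_enorm.tendsto _).comp h1
  refine le_of_tendsto' h2 fun s => ?_
  exact (enorm_sum_le _ _).trans (ENNReal.sum_le_tsum s)

lemma enorm_sq_le_tsum_tsum {ι : Type*} {f : ι → H} {S : H} (hf : HasSum f S) :
    ‖S‖ₑ ^ 2 ≤ ∑' i, ∑' j, ‖inner ℂ (f i) (f j)‖ₑ := by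
  rw [← enorm_inner_self]
  refine (enorm_inner_le_tsum hf S).trans (ENNReal.tsum_le_tsum fun i => ?_)
  rw [enorm_inner_comm]
  exact enorm_inner_le_tsum hf (f i)

end Inner

section Discrete

lemma tsum_tsum_mul_le (a b : ℤ → ℝ≥0∞) (K : ℤ → ℤ → ℝ≥0∞) (C : ℝ≥0∞)
    (h1 : ∀ n, ∑' m, K n m ≤ C) (h2 : ∀ m, ∑' n, K n m ≤ C) :
    ∑' n, ∑' m, a n * b m * K n m
      ≤ C * ((∑' n, a n ^ 2) ^ (1 / 2 : ℝ) * (∑' m, b m ^ 2) ^ (1 / 2 : ℝ)) := by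
  have hsq : ∀ x : ℝ≥0∞, x ^ (1 / 2 : ℝ) * x ^ (1 / 2 : ℝ) = x := fun x => by
    rw [← ENNReal.rpow_add_of_nonneg _ _ (by norm_num) (by norm_num)]; norm_num
  have hsq' : ∀ x : ℝ≥0∞, (x ^ (1 / 2 : ℝ)) ^ (2 : ℝ) = x := fun x => by
    rw [← ENNReal.rpow_mul]; norm_num
  have hcs := ENNReal.lintegral_mul_le_Lp_mul_Lq (Measure.count : Measure (ℤ × ℤ))
    Real.HolderConjugate.two_two
    (f := fun z => a z.1 * K z.1 z.2 ^ (1 / 2 : ℝ)) (g := fun z => b z.2 * K z.1 z.2 ^ (1 / 2 : ℝ))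
    (measurable_of_countable _).aemeasurable (measurable_of_countable _).aemeasurable
  simp only [lintegral_count, Pi.mul_apply] at hcs
  rw [ENNReal.tsum_prod', ENNReal.tsum_prod', ENNReal.tsum_prod'] at hcs
  calc _ = ∑' n, ∑' m, a n * K n m ^ (1 / 2 : ℝ) * (b m * K n m ^ (1 / 2 : ℝ)) := by
        congr! 4 with n m
        conv_lhs => rw [← hsq (K n m)]
        ring
    _ ≤ _ := hcs
    _ ≤ (C * ∑' n, a n ^ 2) ^ (1 / 2 : ℝ) * (C * ∑' m, b m ^ 2) ^ (1 / 2 : ℝ) := by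
        gcongr ?_ ^ _ * ?_ ^ _
        · simp only [ENNReal.mul_rpow_of_nonneg _ _ (zero_le_two : (0:ℝ) ≤ 2), hsq',
            ENNReal.rpow_ofNat, ENNReal.tsum_mul_left]
          rw [← ENNReal.tsum_mul_left]
          refine ENNReal.tsum_le_tsum fun n => ?_
          rw [mul_comm]; gcongr; exact h1 n
        · rw [ENNReal.tsum_comm]
          simp only [ENNReal.mul_rpow_of_nonneg _ _ (zero_le_two : (0:ℝ) ≤ 2), hsq',
            ENNReal.rpow_ofNat, ENNReal.tsum_mul_left]
          rw [← ENNReal.tsum_mul_left]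
          refine ENNReal.tsum_le_tsum fun n => ?_
          rw [mul_comm]; gcongr; exact h2 n
    _ = _ := by
        rw [ENNReal.mul_rpow_of_nonneg _ _ (by norm_num), ENNReal.mul_rpow_of_nonneg _ _ (by norm_num)]
        conv_rhs => rw [← hsq C]
        ring

end Discrete

section Atoms

/-- Vector-valued functions `v n` of time whose size and correlations are controlled, at scale
`2 ^ n`, by scalar functions `c n`. -/
structure DispersiveAtoms {H : Type*} [NormedAddCommGroup H] [InnerProductSpace ℂ H]
    (σ α β : ℝ) (B : ℝ≥0∞) (c : ℤ → ℝ → ℝ≥0∞) (v : ℤ → ℝ → H) : Prop where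
  measurable : ∀ n, Measurable (c n)
  integrable : ∀ n, Integrable (v n)
  enorm_le : ∀ n s, ‖v n s‖ₑ ≤ B * c n s * 2 ^ (-α * n)
  inner_le : ∀ n m s t, ‖inner ℂ (v n s) (v m t)‖ₑ
    ≤ B ^ 2 * (c n s * c m t) * (2 ^ (β * (n + m)) * ENNReal.ofReal |s - t| ^ (-σ))

lemma ENNReal.ofReal_eq_two_rpow_logb {x : ℝ} (hx : 0 < x) :
    ENNReal.ofReal x = 2 ^ Real.logb 2 x := by
  conv_lhs => rw [← Real.rpow_logb zero_lt_two (by norm_num) hx]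
  rw [← ENNReal.ofReal_rpow_of_pos zero_lt_two]
  simp

lemma ENNReal.two_rpow_mul (x y : ℝ) : (2 : ℝ≥0∞) ^ x * 2 ^ y = 2 ^ (x + y) :=
  (ENNReal.rpow_add _ _ (by norm_num) (by norm_num)).symm

variable {H : Type*} [NormedAddCommGroup H] [InnerProductSpace ℂ H] {σ α β : ℝ} {B : ℝ≥0∞}
  {c : ℤ → ℝ → ℝ≥0∞} {v : ℤ → ℝ → H}

lemma DispersiveAtoms.inner_le_of_enorm_le (hv : DispersiveAtoms σ α β B c v) (n m : ℤ) (s t : ℝ) :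
    ‖inner ℂ (v n s) (v m t)‖ₑ ≤ B ^ 2 * (c n s * c m t) * 2 ^ (-α * (n + m)) := by
  calc _ ≤ (B * c n s * 2 ^ (-α * n)) * (B * c m t * 2 ^ (-α * m)) :=
        (enorm_inner_le_enorm _ _).trans (mul_le_mul' (hv.enorm_le n s) (hv.enorm_le m t))
    _ = B ^ 2 * (c n s * c m t) * (2 ^ (-α * n) * 2 ^ (-α * m)) := by ring
    _ = _ := by rw [ENNReal.two_rpow_mul]; ring_nf

lemma DispersiveAtoms.inner_le_interpolated (hv : DispersiveAtoms σ α β B c v) {ε γ : ℝ}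
    (hεα : ε ≤ α) (hεβ : ε ≤ β) (hαβ : α + β = 1 / 2) (hγ : γ = 2 * σ * α) (n m : ℤ) {s t : ℝ}
    (hst : s ≠ t) :
    ‖inner ℂ (v n s) (v m t)‖ₑ ≤ B ^ 2 * ENNReal.ofReal |s - t| ^ (-γ) *
      (c n s * c m t * 2 ^ (-ε * |(n : ℝ) + m - 2 * σ * Real.logb 2 (|s - t|)|)) := by
  have hτ : 0 < |s - t| := abs_pos.2 (sub_ne_zero.2 hst)
  have h1 := hv.inner_le_of_enorm_le n m s t
  have h2 := hv.inner_le n m s t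
  rw [ENNReal.ofReal_eq_two_rpow_logb hτ, ← ENNReal.rpow_mul] at h2 ⊢
  set l := Real.logb 2 |s - t|
  have key : ∀ x : ℝ, ‖inner ℂ (v n s) (v m t)‖ₑ ≤ B ^ 2 * (c n s * c m t) * 2 ^ x →
      x ≤ l * -γ + -ε * |(n : ℝ) + m - 2 * σ * l| → ‖inner ℂ (v n s) (v m t)‖ₑ ≤
        B ^ 2 * 2 ^ (l * -γ) * (c n s * c m t * 2 ^ (-ε * |(n : ℝ) + m - 2 * σ * l|)) := by
    intro x hx hxle
    calc _ ≤ B ^ 2 * (c n s * c m t) * 2 ^ x := hx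
      _ ≤ B ^ 2 * (c n s * c m t) * (2 ^ (l * -γ) * 2 ^ (-ε * |(n : ℝ) + m - 2 * σ * l|)) := by
          rw [ENNReal.two_rpow_mul]; gcongr; norm_num
      _ = _ := by ring
  rcases le_total 0 ((n : ℝ) + m - 2 * σ * l) with h | h
  · refine key _ h1 ?_
    rw [abs_of_nonneg h, hγ]
    nlinarith
  · rw [ENNReal.two_rpow_mul] at h2
    refine key _ h2 ?_
    rw [abs_of_nonpos h, hγ]
    have hα : α = 1 / 2 - β := by linarith
    rw [hα]
    nlinarith

/-- The estimate for sums of dispersive atoms in the range where the Hardy–Littlewood–Sobolev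
inequality applies. -/
lemma exists_enorm_sq_le_of_dispersiveAtoms {σ α β γ p : ℝ} (hσ : 0 < σ) (hα : 0 < α) (hβ : 0 < β)
    (hαβ : α + β = 1 / 2) (hγ : γ = 2 * σ * α) (hγ1 : γ < 1) (hp : p = 2 / (2 - γ)) :
    ∃ C : ℝ≥0∞, C ≠ ∞ ∧ ∀ (H : Type*) [NormedAddCommGroup H] [InnerProductSpace ℂ H]
      [CompleteSpace H] (B : ℝ≥0∞) (c : ℤ → ℝ → ℝ≥0∞) (v : ℤ → ℝ → H) (S : H),
      DispersiveAtoms σ α β B c v → HasSum (fun n => ∫ s, v n s) S →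
      ‖S‖ₑ ^ 2 ≤ C * B ^ 2 * (∫⁻ s, ((∑' n, c n s ^ 2) ^ (1 / 2 : ℝ)) ^ p) ^ (2 / p) := by
  have hε : 0 < min α β := lt_min hα hβ
  obtain ⟨D, hD, hDle⟩ := exists_tsum_two_rpow_neg_abs_le hε
  refine ⟨D * (2 * (ENNReal.ofReal (2 / (1 - γ)) + 2)), by finiteness, ?_⟩
  intro H _ _ _ B c v S hv hS
  set f : ℝ → ℝ≥0∞ := fun s => (∑' n, c n s ^ 2) ^ (1 / 2 : ℝ)
  have hf : Measurable f :=
    (Measurable.tsum fun n => (hv.measurable n).pow_const 2).pow_const _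
  have hc := hv.measurable
  have hpt : ∀ s t, s ≠ t → ∑' n, ∑' m, ‖inner ℂ (v n s) (v m t)‖ₑ
      ≤ D * B ^ 2 * (f s * f t * ENNReal.ofReal |s - t| ^ (-γ)) := by
    intro s t hst
    calc _ ≤ ∑' n, ∑' m, B ^ 2 * ENNReal.ofReal |s - t| ^ (-γ) * (c n s * c m t *
            2 ^ (-min α β * |((n : ℤ) : ℝ) + (m : ℤ) - 2 * σ * Real.logb 2 (|s - t|)|)) :=
          ENNReal.tsum_le_tsum fun n => ENNReal.tsum_le_tsum fun m =>
            hv.inner_le_interpolated (min_le_left _ _) (min_le_right _ _) hαβ hγ n m hst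
      _ ≤ B ^ 2 * ENNReal.ofReal |s - t| ^ (-γ) * (D * (f s * f t)) := by
          simp only [ENNReal.tsum_mul_left]
          gcongr
          refine tsum_tsum_mul_le _ _ _ D (fun n => ?_) (fun m => ?_)
          · refine le_trans (le_of_eq ?_) (hDle (2 * σ * Real.logb 2 (|s - t|) - n))
            congr! 4 with m
            ring_nf
          · refine le_trans (le_of_eq ?_) (hDle (2 * σ * Real.logb 2 (|s - t|) - m))
            congr! 4 with n
            ring_nf
      _ = _ := by ring
  calc ‖S‖ₑ ^ 2 ≤ ∑' n, ∑' m, ‖inner ℂ (∫ s, v n s) (∫ t, v m t)‖ₑ := enorm_sq_le_tsum_tsum hS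
    _ ≤ ∑' n, ∑' m, ∫⁻ s, ∫⁻ t, ‖inner ℂ (v n s) (v m t)‖ₑ :=
        ENNReal.tsum_le_tsum fun n => ENNReal.tsum_le_tsum fun m => enorm_inner_integral_le _ _ _ _
    _ = ∫⁻ s, ∫⁻ t, ∑' n, ∑' m, ‖inner ℂ (v n s) (v m t)‖ₑ := by
        have hm : ∀ n m s, AEMeasurable fun t => ‖inner ℂ (v n s) (v m t)‖ₑ := fun n m s =>
          ((hv.integrable m).aestronglyMeasurable.const_inner).enorm
        have hm2 : ∀ n m, AEMeasurable fun s => ∫⁻ t, ‖inner ℂ (v n s) (v m t)‖ₑ := fun n m =>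
          AEMeasurable.lintegral_prod_right' (f := fun z : ℝ × ℝ => ‖inner ℂ (v n z.1) (v m z.2)‖ₑ)
            ((hv.integrable n).aestronglyMeasurable.comp_fst.inner
              (hv.integrable m).aestronglyMeasurable.comp_snd).enorm
        rw [eq_comm]
        calc _ = ∫⁻ s, ∑' n, ∑' m, ∫⁻ t, ‖inner ℂ (v n s) (v m t)‖ₑ := by
              congr with s
              rw [lintegral_tsum fun n => AEMeasurable.tsum fun m => hm n m s]
              congr with n
              exact lintegral_tsum fun m => hm n m s
          _ = _ := by
              rw [lintegral_tsum fun n => AEMeasurable.tsum fun m => hm2 n m]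
              congr with n
              exact lintegral_tsum fun m => hm2 n m
    _ ≤ ∫⁻ s, ∫⁻ t, D * B ^ 2 * (f s * f t * ENNReal.ofReal |s - t| ^ (-γ)) := by
        refine lintegral_mono fun s => lintegral_mono_ae ?_
        filter_upwards [compl_mem_ae_iff.2 (measure_singleton s)] with t ht
        exact hpt s t (Ne.symm ht)
    _ = D * B ^ 2 * ∫⁻ s, ∫⁻ t, f s * f t * ENNReal.ofReal |s - t| ^ (-γ) := by
        have hK : Measurable fun z : ℝ × ℝ => f z.1 * f z.2 * ENNReal.ofReal |z.1 - z.2| ^ (-γ) := by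
          fun_prop
        rw [← lintegral_const_mul _ hK.lintegral_prod_right']
        congr with s
        exact lintegral_const_mul _ (hK.comp measurable_prodMk_left)
    _ ≤ D * B ^ 2 * (2 * (ENNReal.ofReal (2 / (1 - γ)) + 2) * (∫⁻ s, f s ^ p) ^ (2 / p)) := by
        gcongr
        exact hardy_littlewood_sobolev (by rw [hγ]; positivity) hγ1 hp hf
    _ = _ := by ring

end Atoms

section Endpoint

/-- Times at distance comparable to `2 ^ j` from `t`. -/
def timeAnnulus (t : ℝ) (j : ℤ) : Set ℝ := {s | (2 : ℝ) ^ j ≤ |s - t| ∧ |s - t| < 2 ^ (j + 1)}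

/-- The indicator function of the interval of length `2 ^ (j + 2)` centred at the origin. -/
def dyadicWindow (j : ℤ) : ℝ → ℝ≥0∞ := {z : ℝ | |z| ≤ (2 : ℝ) ^ (j + 1)}.indicator 1

lemma measurableSet_timeAnnulus (t : ℝ) (j : ℤ) : MeasurableSet (timeAnnulus t j) := by
  have h : Measurable fun s : ℝ => |s - t| := by fun_prop
  exact (measurableSet_le measurable_const h).inter (measurableSet_lt h measurable_const)

lemma disjoint_timeAnnulus (t : ℝ) : Pairwise (Function.onFun Disjoint (timeAnnulus t)) := by
  have key : ∀ i j : ℤ, i < j → Disjoint (timeAnnulus t i) (timeAnnulus t j) := by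
    refine fun i j hij => Set.disjoint_left.2 fun s hi hj => ?_
    have : (2 : ℝ) ^ (i + 1) ≤ 2 ^ j := zpow_le_zpow_right₀ one_le_two hij
    linarith [hi.2, hj.1]
  intro i j hij
  rcases lt_or_gt_of_ne hij with h | h
  exacts [key i j h, (key j i h).symm]

lemma iUnion_timeAnnulus (t : ℝ) : ⋃ j, timeAnnulus t j = {t}ᶜ := by
  ext s
  simp only [Set.mem_iUnion, Set.mem_compl_iff, Set.mem_singleton_iff]
  constructor
  · rintro ⟨j, hj, -⟩ rfl
    have : (0 : ℝ) < 2 ^ j := by positivity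
    simp at hj
    linarith
  · intro hs
    obtain ⟨j, h1, h2⟩ := exists_mem_Ico_zpow (abs_pos.2 (sub_ne_zero.2 hs)) one_lt_two
    exact ⟨j, h1, h2⟩

lemma measurable_dyadicWindow (j : ℤ) : Measurable (dyadicWindow j) :=
  measurable_one.indicator (measurableSet_le (by fun_prop) measurable_const)

lemma ofReal_two_zpow (j : ℤ) : ENNReal.ofReal ((2 : ℝ) ^ j) = 2 ^ (j : ℝ) := by
  rw [← Real.rpow_intCast, ← ENNReal.ofReal_rpow_of_pos zero_lt_two]
  simp

lemma lintegral_dyadicWindow (j : ℤ) : ∫⁻ z, dyadicWindow j z = 4 * 2 ^ (j : ℝ) := by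
  have hS : {z : ℝ | |z| ≤ (2 : ℝ) ^ (j + 1)} = Set.Icc (-(2 : ℝ) ^ (j + 1)) (2 ^ (j + 1)) := by
    ext z; exact abs_le (G := ℝ)
  rw [dyadicWindow, lintegral_indicator_one (measurableSet_le (by fun_prop) measurable_const), hS,
    Real.volume_Icc, show (2 : ℝ) ^ (j + 1) - -2 ^ (j + 1) = 4 * 2 ^ j by
      rw [zpow_add₀ two_ne_zero, zpow_one]; ring,
    ENNReal.ofReal_mul (by norm_num), ofReal_two_zpow]
  simp

lemma indicator_timeAnnulus_le (t : ℝ) (j : ℤ) (f : ℝ → ℝ≥0∞) (s : ℝ) :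
    (timeAnnulus t j).indicator f s ≤ f s * dyadicWindow j (t - s) := by
  by_cases hs : s ∈ timeAnnulus t j
  · rw [Set.indicator_of_mem hs, dyadicWindow, Set.indicator_of_mem, Pi.one_apply, mul_one]
    rw [Set.mem_ofPred_eq, abs_sub_comm]
    exact hs.2.le
  · rw [Set.indicator_of_notMem hs]
    exact zero_le

variable {H : Type*} [NormedAddCommGroup H] [InnerProductSpace ℂ H]
  {σ α β : ℝ} {B : ℝ≥0∞} {c : ℤ → ℝ → ℝ≥0∞} {v : ℤ → ℝ → H}

lemma DispersiveAtoms.enorm_inner_integral_le_lintegral_tsum [CompleteSpace H]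
    (hv : DispersiveAtoms σ α β B c v)
    (n m : ℤ) : ‖inner ℂ (∫ s, v n s) (∫ t, v m t)‖ₑ
      ≤ ∫⁻ t, ∑' j, ‖inner ℂ (v m t) (∫ s in timeAnnulus t j, v n s)‖ₑ := by
  refine (enorm_inner_integral_right_le volume _ (v m)).trans (lintegral_mono fun t => ?_)
  rw [enorm_inner_comm]
  refine enorm_inner_le_tsum ?_ _
  have h := hasSum_integral_iUnion (fun j => measurableSet_timeAnnulus t j)
    (disjoint_timeAnnulus t) (hv.integrable n).integrableOn
  rwa [iUnion_timeAnnulus, setIntegral_congr_set (t := Set.univ), setIntegral_univ] at h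
  exact eventuallyEq_univ.2 (compl_mem_ae_iff.2 (measure_singleton t))

lemma DispersiveAtoms.enorm_inner_annulus_le [CompleteSpace H] (hv : DispersiveAtoms σ α β B c v)
    (hσ : 0 ≤ σ)
    (n m j : ℤ) (t : ℝ) : ‖inner ℂ (v m t) (∫ s in timeAnnulus t j, v n s)‖ₑ
      ≤ B ^ 2 * 2 ^ (β * (n + m) - σ * j) * ∫⁻ s, c m t * c n s * dyadicWindow j (t - s) := by
  have hcn := hv.measurable n
  have hm : Measurable fun s => c m t * c n s * dyadicWindow j (t - s) :=
    (hcn.const_mul _).mul ((measurable_dyadicWindow j).comp (measurable_id.const_sub t))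
  calc _ ≤ ∫⁻ s in timeAnnulus t j, ‖inner ℂ (v m t) (v n s)‖ₑ := enorm_inner_integral_right_le _ _ _
    _ ≤ ∫⁻ s in timeAnnulus t j, B ^ 2 * 2 ^ (β * (n + m) - σ * j) * (c m t * c n s) := by
        refine setLIntegral_mono' (measurableSet_timeAnnulus t j) fun s hs => ?_
        refine (hv.inner_le m n t s).trans ?_
        have h : ENNReal.ofReal |t - s| ^ (-σ) ≤ 2 ^ (-(σ * j)) := by
          rw [ENNReal.rpow_neg, ENNReal.rpow_neg, ENNReal.inv_le_inv, mul_comm, ENNReal.rpow_mul,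
            ← ofReal_two_zpow]
          gcongr
          rw [abs_sub_comm]; exact hs.1
        calc _ ≤ B ^ 2 * (c m t * c n s) * (2 ^ (β * (m + n)) * 2 ^ (-(σ * j))) := by gcongr
          _ = _ := by rw [ENNReal.two_rpow_mul]; ring_nf
    _ ≤ ∫⁻ s, B ^ 2 * 2 ^ (β * (n + m) - σ * j) * (c m t * c n s * dyadicWindow j (t - s)) := by
        rw [← lintegral_indicator (measurableSet_timeAnnulus t j)]
        refine lintegral_mono fun s => (indicator_timeAnnulus_le t j _ s).trans (le_of_eq ?_)
        ring
    _ = _ := lintegral_const_mul _ hm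

lemma DispersiveAtoms.inner_le_rpow_neg_half (hv : DispersiveAtoms σ α β B c v) (hσ : 1 ≤ σ)
    (hα : 2 * σ * α = 1) (hαβ : α + β = 1 / 2) (n : ℤ) {s t : ℝ} (hst : s ≠ t) :
    ‖inner ℂ (v n s) (v n t)‖ₑ
      ≤ B ^ 2 * 2 ^ (-α * n) * (c n s * c n t * ENNReal.ofReal |s - t| ^ (-(1 / 2 : ℝ))) := by
  have hτ : 0 < |s - t| := abs_pos.2 (sub_ne_zero.2 hst)
  have hα0 : 0 < α := by
    by_contra! h; nlinarith
  have hα1 : α ≤ 1 := by nlinarith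
  have h1 := hv.inner_le_of_enorm_le n n s t
  have h2 := hv.inner_le n n s t
  rw [ENNReal.ofReal_eq_two_rpow_logb hτ, ← ENNReal.rpow_mul] at h2 ⊢
  set l := Real.logb 2 |s - t|
  rw [ENNReal.two_rpow_mul] at h2
  set x := -α * ((n : ℝ) + n)
  set y := β * ((n : ℝ) + n) + l * -σ
  have hxy : (1 - α) * x + α * y = -α * n + l * -(1 / 2) := by
    have hβ : β = 1 / 2 - α := by linarith
    simp only [x, y, hβ]
    linear_combination (-l / 2) * hα
  have key : ∀ z : ℝ, ‖inner ℂ (v n s) (v n t)‖ₑ ≤ B ^ 2 * (c n s * c n t) * 2 ^ z →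
      z ≤ -α * n + l * -(1 / 2) → ‖inner ℂ (v n s) (v n t)‖ₑ ≤
        B ^ 2 * 2 ^ (-α * n) * (c n s * c n t * 2 ^ (l * -(1 / 2))) := by
    intro z hz hzle
    calc _ ≤ B ^ 2 * (c n s * c n t) * 2 ^ z := hz
      _ ≤ B ^ 2 * (c n s * c n t) * (2 ^ (-α * n) * 2 ^ (l * -(1 / 2))) := by
          rw [ENNReal.two_rpow_mul]; gcongr; norm_num
      _ = _ := by ring
  rcases le_total x y with h | h
  · exact key x h1 (by nlinarith)
  · exact key y h2 (by nlinarith)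

lemma DispersiveAtoms.enorm_integral_annulus_sq_le [CompleteSpace H]
    (hv : DispersiveAtoms σ α β B c v)
    (hσ : 1 ≤ σ) (hα : 2 * σ * α = 1) (hαβ : α + β = 1 / 2) (n j : ℤ) (t : ℝ) :
    ‖∫ s in timeAnnulus t j, v n s‖ₑ ^ 2
      ≤ 16 * B ^ 2 * 2 ^ (j / 2 - α * n) * ∫⁻ s, c n s ^ 2 * dyadicWindow j (t - s) := by
  set W := timeAnnulus t j
  have hW : MeasurableSet W := measurableSet_timeAnnulus t j
  set ρ : ℝ := 2 ^ (j + 2)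
  set K : ℝ → ℝ≥0∞ := {z : ℝ | |z| ≤ ρ}.indicator fun z => ENNReal.ofReal |z| ^ (-(1 / 2 : ℝ))
  have hρm : MeasurableSet {z : ℝ | |z| ≤ ρ} := measurableSet_le (by fun_prop) measurable_const
  have hK : Measurable K := Measurable.indicator (by fun_prop) hρm
  have hKint : ∫⁻ z, K z ≤ 8 * 2 ^ ((j : ℝ) / 2) := by
    rw [lintegral_indicator hρm]
    refine (lintegral_abs_rpow_neg_near (by norm_num) (by norm_num) (by positivity)).trans ?_
    rw [ofReal_two_zpow, ← ENNReal.rpow_mul, show (8 : ℝ≥0∞) = 4 * 2 ^ (1 : ℝ) by norm_num, mul_assoc,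
      ENNReal.two_rpow_mul]
    norm_num
    gcongr
    · norm_num
    · linarith
  set f := W.indicator (c n)
  have hf : Measurable f := (hv.measurable n).indicator hW
  calc ‖∫ s in W, v n s‖ₑ ^ 2 ≤ ∫⁻ s in W, ∫⁻ s' in W, ‖inner ℂ (v n s) (v n s')‖ₑ := by
        rw [← enorm_inner_self]; exact enorm_inner_integral_le _ _ _ _
    _ ≤ ∫⁻ s, ∫⁻ s', B ^ 2 * 2 ^ (-α * n) * (f s * f s' * K (s - s')) := by
        rw [← lintegral_indicator hW]
        refine lintegral_mono fun s => ?_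
        by_cases hs : s ∈ W
        swap
        · rw [Set.indicator_of_notMem hs]; exact zero_le
        rw [Set.indicator_of_mem hs, ← lintegral_indicator hW]
        refine lintegral_mono_ae ?_
        filter_upwards [compl_mem_ae_iff.2 (measure_singleton s)] with s' hss'
        by_cases hs' : s' ∈ W
        swap
        · rw [Set.indicator_of_notMem hs']; exact zero_le
        have hmem : s - s' ∈ {z : ℝ | |z| ≤ ρ} := by
          have h2 : ρ = 2 ^ (j + 1) + 2 ^ (j + 1) := by
            simp only [ρ]
            rw [show j + 2 = j + 1 + 1 by ring, zpow_add_one₀ two_ne_zero, mul_two]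
          have h3 := abs_sub_le s t s'
          have h4 := hs'.2
          rw [abs_sub_comm] at h4
          rw [Set.mem_ofPred_eq]
          linarith [hs.2]
        simp only [f, K, Set.indicator_of_mem hs, Set.indicator_of_mem hs', Set.indicator_of_mem hmem]
        exact hv.inner_le_rpow_neg_half hσ hα hαβ n (Ne.symm hss')
    _ = B ^ 2 * 2 ^ (-α * n) * ∫⁻ s, ∫⁻ s', f s * f s' * K (s - s') := by
        have hm : Measurable fun z : ℝ × ℝ => f z.1 * f z.2 * K (z.1 - z.2) := by fun_prop
        rw [← lintegral_const_mul _ hm.lintegral_prod_right']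
        congr with s
        exact lintegral_const_mul _ (hm.comp measurable_prodMk_left)
    _ ≤ B ^ 2 * 2 ^ (-α * n) * (8 * 2 ^ ((j : ℝ) / 2) * ((∫⁻ s, f s ^ 2) + ∫⁻ s, f s ^ 2)) := by
        gcongr
        exact (lintegral_mul_mul_kernel_le volume hf.aemeasurable hf.aemeasurable hK).trans
          (by gcongr)
    _ = 16 * B ^ 2 * 2 ^ (j / 2 - α * n) * ∫⁻ s, f s ^ 2 := by
        rw [show (j : ℝ) / 2 - α * n = -α * n + j / 2 by ring, ← ENNReal.two_rpow_mul]; ring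
    _ ≤ _ := by
        gcongr with s
        refine le_trans (le_of_eq ?_) (indicator_timeAnnulus_le t j (fun s => c n s ^ 2) s)
        by_cases hs : s ∈ W
        · simp [f, W, Set.indicator_of_mem hs]
        · simp [f, W, Set.indicator_of_notMem hs]

end Endpoint

section Endpoint

variable {H : Type*} [NormedAddCommGroup H] [InnerProductSpace ℂ H] [CompleteSpace H]
  {σ α β : ℝ} {B : ℝ≥0∞} {c : ℤ → ℝ → ℝ≥0∞} {v : ℤ → ℝ → H}

lemma lintegral_lintegral_mul_dyadicWindow_le {f g : ℝ → ℝ≥0∞} (hf : Measurable f)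
    (hg : Measurable g) (j : ℤ) :
    ∫⁻ t, ∫⁻ s, f t * g s * dyadicWindow j (t - s)
      ≤ 4 * 2 ^ (j : ℝ) * ((∫⁻ t, f t ^ 2) + ∫⁻ s, g s ^ 2) := by
  rw [← lintegral_dyadicWindow]
  exact lintegral_mul_mul_kernel_le volume hf.aemeasurable hg.aemeasurable (measurable_dyadicWindow j)

lemma lintegral_lintegral_dyadicWindow {f : ℝ → ℝ≥0∞} (hf : Measurable f) (j : ℤ) :
    ∫⁻ t, ∫⁻ s, f s * dyadicWindow j (t - s) = 4 * 2 ^ (j : ℝ) * ∫⁻ s, f s := by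
  have hm : Measurable fun z : ℝ × ℝ => f z.2 * dyadicWindow j (z.1 - z.2) :=
    (hf.comp measurable_snd).mul
      ((measurable_dyadicWindow j).comp (measurable_fst.sub measurable_snd))
  rw [lintegral_lintegral_swap hm.aemeasurable]
  simp_rw [← lintegral_dyadicWindow]
  rw [mul_comm, ← lintegral_mul_const _ hf]
  congr with s
  have hs : Measurable fun x => dyadicWindow j (x - s) :=
    (measurable_dyadicWindow j).comp (measurable_id.sub_const s)
  rw [lintegral_const_mul _ hs]
  congr 1
  exact lintegral_sub_right_eq_self (dyadicWindow j) s

lemma DispersiveAtoms.enorm_inner_annulus_le_of_energy (hv : DispersiveAtoms σ α β B c v)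
    (hσ : 1 ≤ σ) (hα : 2 * σ * α = 1) (hαβ : α + β = 1 / 2) (n m j : ℤ) (t : ℝ) :
    ‖inner ℂ (v m t) (∫ s in timeAnnulus t j, v n s)‖ₑ
      ≤ B ^ 2 * (2 ^ (3 / 4 * j - α / 2 * n - α * m) * (c m t ^ 2
        + 16 * 2 ^ (-(j : ℝ)) * ∫⁻ s, c n s ^ 2 * dyadicWindow j (t - s))) := by
  set E := ∫⁻ s, c n s ^ 2 * dyadicWindow j (t - s)
  set Z := ‖∫ s in timeAnnulus t j, v n s‖ₑ
  set w : ℝ := 3 / 4 * j - α / 2 * n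
  have hZ : Z ^ 2 ≤ 16 * B ^ 2 * 2 ^ (j / 2 - α * n) * E :=
    hv.enorm_integral_annulus_sq_le hσ hα hαβ n j t
  have hsq : ∀ x : ℝ, ((2 : ℝ≥0∞) ^ x) ^ 2 = 2 ^ (2 * x) := fun x => by
    rw [sq, ENNReal.two_rpow_mul, two_mul]
  calc _ ≤ ‖v m t‖ₑ * Z := enorm_inner_le_enorm _ _
    _ ≤ B * c m t * 2 ^ (-α * m) * Z := by gcongr; exact hv.enorm_le m t
    _ = 2 ^ (-α * m) * ((B * c m t * 2 ^ (w / 2)) * (2 ^ (-w / 2) * Z)) := by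
        have : (2 : ℝ≥0∞) ^ (w / 2) * 2 ^ (-w / 2) = 1 := by
          rw [ENNReal.two_rpow_mul]; ring_nf; simp
        calc _ = B * c m t * 2 ^ (-α * m) * Z * 1 := by rw [mul_one]
          _ = _ := by rw [← this]; ring
    _ ≤ 2 ^ (-α * m) * ((B * c m t * 2 ^ (w / 2)) ^ 2 + (2 ^ (-w / 2) * Z) ^ 2) := by
        gcongr; exact ENNReal.mul_le_sq_add_sq _ _
    _ ≤ 2 ^ (-α * m) * ((B * c m t * 2 ^ (w / 2)) ^ 2 +
          2 ^ (-w) * (16 * B ^ 2 * 2 ^ (j / 2 - α * n) * E)) := by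
        rw [mul_pow _ Z, hsq, show 2 * (-w / 2) = -w by ring]
        gcongr
    _ = B ^ 2 * ((2 ^ (-α * m) * 2 ^ w) * c m t ^ 2
          + 16 * (2 ^ (-α * m) * 2 ^ (-w) * 2 ^ (j / 2 - α * n)) * E) := by
        rw [mul_pow _ ((2 : ℝ≥0∞) ^ (w / 2)), hsq, show 2 * (w / 2) = w by ring]; ring
    _ = _ := by
        have h : (2 : ℝ≥0∞) ^ (-α * m) * 2 ^ (-w) * 2 ^ (j / 2 - α * n)
            = 2 ^ (w - α * m) * 2 ^ (-(j : ℝ)) := by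
          simp only [ENNReal.two_rpow_mul]
          congr 1
          simp only [w]; ring
        rw [h, ENNReal.two_rpow_mul, show -α * m + w = w - α * m by ring]
        ring

lemma min_le_neg_abs_add_abs {σ x y : ℝ} (hσ : 3 / 2 ≤ σ) (hxy : y ≤ x) :
    min (-(σ - 1) * (x + y) / 2) (y / 2 + x / 4) ≤ -(1 / 32) * (|x| + |y|) := by
  have h1 : 0 ≤ x + y → -(σ - 1) * (x + y) / 2 ≤ -(x + y) / 4 := fun h => by nlinarith
  rcases le_total 0 (x + y) with h | h
  · have h1 := h1 h
    rcases le_total 0 y with hy | hy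
    · rw [abs_of_nonneg hy, abs_of_nonneg (by linarith)]
      exact (min_le_left _ _).trans (by linarith)
    · rw [abs_of_nonpos hy, abs_of_nonneg (by linarith : 0 ≤ x)]
      rcases le_total (-y) (3 / 4 * x) with h3 | h3
      · exact (min_le_left _ _).trans (by linarith)
      · exact (min_le_right _ _).trans (by linarith)
  · refine (min_le_right _ _).trans ?_
    have hx : |x| ≤ -y := abs_le.2 ⟨by linarith, by linarith⟩
    rw [abs_of_nonpos (by linarith : y ≤ 0)]
    linarith [le_abs_self x]

lemma DispersiveAtoms.enorm_inner_integral_le_tsum (hv : DispersiveAtoms σ α β B c v)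
    (hσ : 3 / 2 ≤ σ) (hα : 2 * σ * α = 1) (hαβ : α + β = 1 / 2) {n m : ℤ} (hnm : n ≤ m) :
    ‖inner ℂ (∫ s, v n s) (∫ t, v m t)‖ₑ ≤
      ∑' j : ℤ, 64 * B ^ 2 * 2 ^ (-(1 / 32 : ℝ) * (|j - 2 * α * n| + |j - 2 * α * m|)) *
        ((∫⁻ s, c n s ^ 2) + ∫⁻ s, c m s ^ 2) := by
  have hcn := hv.measurable n
  have hcm := hv.measurable m
  have hα0 : 0 < α := by
    by_contra! h; nlinarith
  have hKm : ∀ j : ℤ, Measurable fun z : ℝ × ℝ => dyadicWindow j (z.1 - z.2) := fun j =>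
    (measurable_dyadicWindow j).comp (measurable_fst.sub measurable_snd)
  have hP : ∀ j : ℤ, Measurable fun t => B ^ 2 * 2 ^ (β * (n + m) - σ * j) *
      ∫⁻ s, c m t * c n s * dyadicWindow j (t - s) := fun j =>
    (Measurable.lintegral_prod_right' (f := fun z : ℝ × ℝ =>
      c m z.1 * c n z.2 * dyadicWindow j (z.1 - z.2))
      (((hcm.comp measurable_fst).mul (hcn.comp measurable_snd)).mul (hKm j))).const_mul _
  have hE : ∀ j : ℤ, Measurable fun t => ∫⁻ s, c n s ^ 2 * dyadicWindow j (t - s) := fun j =>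
    Measurable.lintegral_prod_right' (f := fun z : ℝ × ℝ => c n z.2 ^ 2 * dyadicWindow j (z.1 - z.2))
      (((hcn.comp measurable_snd).pow_const 2).mul (hKm j))
  have hQ : ∀ j : ℤ, Measurable fun t => B ^ 2 * (2 ^ (3 / 4 * j - α / 2 * n - α * m) * (c m t ^ 2
        + 16 * 2 ^ (-(j : ℝ)) * ∫⁻ s, c n s ^ 2 * dyadicWindow j (t - s))) := fun j =>
    (((hcm.pow_const 2).add ((hE j).const_mul _)).const_mul _).const_mul _
  refine (hv.enorm_inner_integral_le_lintegral_tsum n m).trans ?_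
  calc _ ≤ ∫⁻ t, ∑' j : ℤ, min (B ^ 2 * 2 ^ (β * (n + m) - σ * j) *
            ∫⁻ s, c m t * c n s * dyadicWindow j (t - s))
          (B ^ 2 * (2 ^ (3 / 4 * j - α / 2 * n - α * m) * (c m t ^ 2
            + 16 * 2 ^ (-(j : ℝ)) * ∫⁻ s, c n s ^ 2 * dyadicWindow j (t - s)))) := by
        gcongr with t j
        exact le_min (hv.enorm_inner_annulus_le (by linarith) n m j t)
          (hv.enorm_inner_annulus_le_of_energy (by linarith) hα hαβ n m j t)
    _ = ∑' j : ℤ, _ := lintegral_tsum fun j => ((hP j).min (hQ j)).aemeasurable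
    _ ≤ _ := by
        refine ENNReal.tsum_le_tsum fun j => ?_
        set x := j - 2 * α * n
        set y := j - 2 * α * m
        have hxy : y ≤ x := by
          have : (n : ℝ) ≤ m := by exact_mod_cast hnm
          simp only [x, y]; nlinarith
        rcases min_le_iff.1 (min_le_neg_abs_add_abs hσ hxy) with h | h
        · calc _ ≤ ∫⁻ t, B ^ 2 * 2 ^ (β * (n + m) - σ * j) *
                ∫⁻ s, c m t * c n s * dyadicWindow j (t - s) := lintegral_mono fun t => min_le_left _ _
            _ = B ^ 2 * 2 ^ (β * (n + m) - σ * j) *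
                ∫⁻ t, ∫⁻ s, c m t * c n s * dyadicWindow j (t - s) := by
                refine lintegral_const_mul _ ?_
                exact Measurable.lintegral_prod_right' (f := fun z : ℝ × ℝ =>
                  c m z.1 * c n z.2 * dyadicWindow j (z.1 - z.2))
                  (((hcm.comp measurable_fst).mul (hcn.comp measurable_snd)).mul (hKm j))
            _ ≤ B ^ 2 * 2 ^ (β * (n + m) - σ * j) *
                (4 * 2 ^ (j : ℝ) * ((∫⁻ t, c m t ^ 2) + ∫⁻ s, c n s ^ 2)) := by
                gcongr; exact lintegral_lintegral_mul_dyadicWindow_le hcm hcn j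
            _ = 4 * B ^ 2 * 2 ^ (-(σ - 1) * (x + y) / 2) *
                ((∫⁻ s, c n s ^ 2) + ∫⁻ s, c m s ^ 2) := by
                have hβ : β = 1 / 2 - α := by linarith
                have : (2 : ℝ≥0∞) ^ (-(σ - 1) * (x + y) / 2)
                    = 2 ^ (β * (n + m) - σ * j) * 2 ^ (j : ℝ) := by
                  rw [ENNReal.two_rpow_mul]
                  congr 1
                  simp only [x, y, hβ]
                  linear_combination (n + m : ℝ) / 2 * hα
                rw [this]; ring
            _ ≤ _ := by gcongr <;> norm_num
        · calc _ ≤ ∫⁻ t, B ^ 2 * (2 ^ (3 / 4 * j - α / 2 * n - α * m) * (c m t ^ 2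
                + 16 * 2 ^ (-(j : ℝ)) * ∫⁻ s, c n s ^ 2 * dyadicWindow j (t - s))) :=
                lintegral_mono fun t => min_le_right _ _
            _ = B ^ 2 * (2 ^ (3 / 4 * j - α / 2 * n - α * m) * ((∫⁻ t, c m t ^ 2)
                + 16 * 2 ^ (-(j : ℝ)) * (4 * 2 ^ (j : ℝ) * ∫⁻ s, c n s ^ 2))) := by
                have hE' : Measurable fun t => c m t ^ 2
                    + 16 * 2 ^ (-(j : ℝ)) * ∫⁻ s, c n s ^ 2 * dyadicWindow j (t - s) :=
                  (hcm.pow_const 2).add ((hE j).const_mul _)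
                rw [lintegral_const_mul _ (hE'.const_mul _), lintegral_const_mul _ hE',
                  lintegral_add_left (hcm.pow_const 2), lintegral_const_mul _ (hE j),
                  lintegral_lintegral_dyadicWindow (hcn.pow_const 2)]
            _ = B ^ 2 * (2 ^ (y / 2 + x / 4) * ((∫⁻ t, c m t ^ 2) + 64 * ∫⁻ s, c n s ^ 2)) := by
                have h1 : (2 : ℝ≥0∞) ^ (-(j : ℝ)) * 2 ^ (j : ℝ) = 1 := by
                  rw [ENNReal.two_rpow_mul]; simp
                have h2 : 16 * 2 ^ (-(j : ℝ)) * (4 * 2 ^ (j : ℝ) * ∫⁻ s, c n s ^ 2)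
                    = 64 * (2 ^ (-(j : ℝ)) * 2 ^ (j : ℝ)) * ∫⁻ s, c n s ^ 2 := by ring
                rw [h2, h1, mul_one, show 3 / 4 * j - α / 2 * n - α * m = y / 2 + x / 4 by
                  simp only [x, y]; ring]
            _ ≤ B ^ 2 * (2 ^ (-(1 / 32 : ℝ) * (|x| + |y|)) *
                  (64 * (∫⁻ t, c m t ^ 2) + 64 * ∫⁻ s, c n s ^ 2)) := by
                gcongr
                · norm_num
                · exact le_mul_of_one_le_left zero_le (by norm_num)
            _ = _ := by ring

/-- The estimate for sums of dispersive atoms at the endpoint. -/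
lemma exists_enorm_sq_le_of_dispersiveAtoms_endpoint {σ α β : ℝ} (hσ : 3 / 2 ≤ σ)
    (hα : 2 * σ * α = 1) (hαβ : α + β = 1 / 2) :
    ∃ C : ℝ≥0∞, C ≠ ∞ ∧ ∀ (H : Type*) [NormedAddCommGroup H] [InnerProductSpace ℂ H]
      [CompleteSpace H] (B : ℝ≥0∞) (c : ℤ → ℝ → ℝ≥0∞) (v : ℤ → ℝ → H) (S : H),
      DispersiveAtoms σ α β B c v → HasSum (fun n => ∫ s, v n s) S →
      ‖S‖ₑ ^ 2 ≤ C * B ^ 2 * ∫⁻ s, ∑' n, c n s ^ 2 := by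
  have hα0 : 0 < α := by
    by_contra! h; nlinarith
  obtain ⟨D, hD, hDle⟩ := exists_tsum_two_rpow_neg_abs_le (ε := 1 / 32) (by norm_num)
  obtain ⟨D', hD', hDle'⟩ := exists_tsum_two_rpow_neg_abs_le (ε := α / 16) (by positivity)
  refine ⟨128 * D * D', by finiteness, ?_⟩
  intro H _ _ _ B c v S hv hS
  set N : ℤ → ℝ≥0∞ := fun n => ∫⁻ s, c n s ^ 2
  set κ : ℤ → ℤ → ℝ≥0∞ := fun j n => 2 ^ (-(1 / 32 : ℝ) * |j - 2 * α * n|)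
  have hκ : ∀ j n m : ℤ, (2 : ℝ≥0∞) ^ (-(1 / 32 : ℝ) * (|j - 2 * α * n| + |j - 2 * α * m|))
      = κ j n * κ j m := fun j n m => by
    simp only [κ, ENNReal.two_rpow_mul]; ring_nf
  have hpair : ∀ n m, ‖inner ℂ (∫ s, v n s) (∫ t, v m t)‖ₑ
      ≤ ∑' j : ℤ, 64 * B ^ 2 * (κ j n * κ j m) * (N n + N m) := by
    intro n m
    rcases le_total n m with h | h
    · simpa only [hκ] using hv.enorm_inner_integral_le_tsum hσ hα hαβ h
    · rw [enorm_inner_comm]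
      have := hv.enorm_inner_integral_le_tsum hσ hα hαβ h
      simp only [hκ] at this
      simpa only [mul_comm (κ _ n), add_comm (N n)] using this
  have hsum : ∀ n, ∑' m : ℤ, ∑' j : ℤ, κ j n * κ j m ≤ D * D' := by
    intro n
    rw [ENNReal.tsum_comm]
    simp only [ENNReal.tsum_mul_left]
    calc _ ≤ ∑' j : ℤ, κ j n * D' := by
          gcongr with j
          refine le_trans (le_of_eq (tsum_congr fun m => ?_)) (hDle' (j / (2 * α)))
          simp only [κ]
          congr 1
          have : (j : ℝ) - 2 * α * m = -(2 * α) * (m - j / (2 * α)) := by field_simp; ring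
          rw [this, abs_mul, abs_neg, abs_of_pos (by positivity : 0 < 2 * α)]
          ring
      _ ≤ _ := by
          rw [ENNReal.tsum_mul_right]; gcongr; exact hDle _
  have hsumN : ∑' n, ∑' m, ∑' j : ℤ, κ j n * κ j m * N n ≤ D * D' * ∑' n, N n := by
    rw [← ENNReal.tsum_mul_left]
    refine ENNReal.tsum_le_tsum fun n => ?_
    simp only [ENNReal.tsum_mul_right]
    gcongr
    exact hsum n
  calc ‖S‖ₑ ^ 2 ≤ ∑' n, ∑' m, ‖inner ℂ (∫ s, v n s) (∫ t, v m t)‖ₑ := enorm_sq_le_tsum_tsum hS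
    _ ≤ ∑' n, ∑' m, ∑' j : ℤ, 64 * B ^ 2 * (κ j n * κ j m) * (N n + N m) :=
        ENNReal.tsum_le_tsum fun n => ENNReal.tsum_le_tsum fun m => hpair n m
    _ = 64 * B ^ 2 * ((∑' n, ∑' m, ∑' j : ℤ, κ j n * κ j m * N n)
          + ∑' n, ∑' m, ∑' j : ℤ, κ j n * κ j m * N m) := by
        simp only [← ENNReal.tsum_add, ← ENNReal.tsum_mul_left]
        congr! 6; ring
    _ = 64 * B ^ 2 * ((∑' n, ∑' m, ∑' j : ℤ, κ j n * κ j m * N n)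
          + ∑' n, ∑' m, ∑' j : ℤ, κ j n * κ j m * N n) := by
        congr 2
        rw [ENNReal.tsum_comm]
        simp only [mul_comm (κ _ _) (κ _ _)]
    _ ≤ 64 * B ^ 2 * (D * D' * ∑' n, N n + D * D' * ∑' n, N n) := by gcongr
    _ = 128 * D * D' * B ^ 2 * ∑' n, N n := by ring
    _ = _ := by
        rw [lintegral_tsum fun n => ((hv.measurable n).pow_const 2).aemeasurable]

end Endpoint

section Family

variable {X : Type*} [MeasurableSpace X] {H : Type*} [NormedAddCommGroup H]
  [InnerProductSpace ℂ H]

/-- A family of vectors `k (t, x)` whose correlations decay like `|s - t| ^ (-σ)` and whose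
superpositions at a fixed time are bounded in `L ^ 2`. -/
structure DispersiveFamily (ν : Measure X) (σ : ℝ) (A : ℝ≥0∞) (k : ℝ × X → H) : Prop where
  stronglyMeasurable : StronglyMeasurable k
  bounded : ∃ M : ℝ, ∀ z, ‖k z‖ ≤ M
  dispersive : ∀ s x t y, ‖inner ℂ (k (s, x)) (k (t, y))‖ₑ ≤ A ^ 2 * ENNReal.ofReal |s - t| ^ (-σ)
  energy : ∀ (t : ℝ) (φ : X → ℂ), Integrable φ ν →
    ‖∫ x, φ x • k (t, x) ∂ν‖ₑ ^ 2 ≤ A ^ 2 * ∫⁻ x, ‖φ x‖ₑ ^ 2 ∂ν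

/-- The layers of the time slices of `F`, as a subset of space-time. -/
def spaceTimeLayer (ν : Measure X) (F : ℝ × X → ℂ) (n : ℤ) : Set (ℝ × X) :=
  {z | z.2 ∈ massLayer ν (fun x => ‖F (z.1, x)‖ₑ) n}

variable {ν : Measure X} {σ p : ℝ} {A : ℝ≥0∞} {k : ℝ × X → H} {F : ℝ × X → ℂ}

lemma measurable_superMass_slice [SFinite ν] (hF : Measurable F) :
    Measurable fun z : ℝ × X => superMass ν (fun x => ‖F (z.1, x)‖ₑ) z.2 := by
  have h : MeasurableSet {w : (ℝ × X) × X | ‖F w.1‖ₑ ≤ ‖F (w.1.1, w.2)‖ₑ} :=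
    measurableSet_le (hF.comp measurable_fst).enorm
      (hF.comp ((measurable_fst.comp measurable_fst).prodMk measurable_snd)).enorm
  exact measurable_measure_prodMk_left h

lemma measurableSet_spaceTimeLayer [SFinite ν] (hF : Measurable F) (n : ℤ) :
    MeasurableSet (spaceTimeLayer ν F n) :=
  (measurableSet_lt measurable_const (measurable_superMass_slice hF)).inter
    (measurableSet_le (measurable_superMass_slice hF) measurable_const)

lemma disjoint_spaceTimeLayer : Pairwise (Function.onFun Disjoint (spaceTimeLayer ν F)) :=
  fun _ _ hmn => Set.disjoint_left.2 fun _ hm hn =>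
    Set.disjoint_left.1 (disjoint_massLayer hmn) hm hn

lemma measurable_slice (hF : Measurable F) (s : ℝ) : Measurable fun x => F (s, x) :=
  hF.comp measurable_prodMk_left

lemma measurable_layerNorm_slice [SFinite ν] (hF : Measurable F) (n : ℤ) :
    Measurable fun s => layerNorm ν p (fun x => ‖F (s, x)‖ₑ) n := by
  have h : ∀ n, Measurable fun s => ∫⁻ x in massLayer ν (fun x => ‖F (s, x)‖ₑ) n, ‖F (s, x)‖ₑ ^ p ∂ν := by
    intro n
    have := ((hF.enorm.pow_const p).indicator
      (measurableSet_spaceTimeLayer (ν := ν) hF n)).lintegral_prod_right' (ν := ν)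
    convert this using 2 with s
    rw [← lintegral_indicator (measurableSet_massLayer (measurable_slice hF s).enorm n)]
    rfl
  exact ((h n).add (h (n - 1))).pow_const _

lemma DispersiveFamily.integrable_smul {μ : Measure (ℝ × X)} (hk : DispersiveFamily ν σ A k)
    (hF : Integrable F μ) : Integrable (fun z => F z • k z) μ := by
  obtain ⟨M, hM⟩ := hk.bounded
  refine Integrable.mono' (hF.norm.mul_const M)
    (hF.aestronglyMeasurable.smul hk.stronglyMeasurable.aestronglyMeasurable) ?_
  filter_upwards with z
  rw [norm_smul]
  gcongr
  exact hM z

lemma integral_spaceTimeLayer {E : Type*} [NormedAddCommGroup E] [NormedSpace ℝ E] [SFinite ν]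
    {G : ℝ × X → E} (hF : Measurable F)
    (hG : Integrable G (volume.prod ν)) (n : ℤ) :
    ∫ z in spaceTimeLayer ν F n, G z ∂(volume.prod ν)
      = ∫ s, ∫ x in massLayer ν (fun x => ‖F (s, x)‖ₑ) n, G (s, x) ∂ν := by
  have hS := measurableSet_spaceTimeLayer (ν := ν) hF n
  rw [← integral_indicator hS, integral_prod _ (hG.indicator hS)]
  congr with s
  rw [← integral_indicator (measurableSet_massLayer (measurable_slice hF s).enorm n)]
  rfl

lemma ae_mem_iUnion_spaceTimeLayer [SFinite ν] (hF : Measurable F)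
    (hFs : ∀ s, Integrable (fun x => F (s, x)) ν) :
    ∀ᵐ z ∂(volume.prod ν), z ∉ ⋃ n, spaceTimeLayer ν F n → F z = 0 := by
  have hm := measurable_superMass_slice (ν := ν) hF
  suffices h : ∀ᵐ z ∂(volume.prod ν), F z = 0 ∨
      superMass ν (fun x => ‖F (z.1, x)‖ₑ) z.2 ≠ 0 ∧ superMass ν (fun x => ‖F (z.1, x)‖ₑ) z.2 ≠ ∞ by
    filter_upwards [h] with z hz hzn
    refine hz.resolve_right fun ⟨h0, htop⟩ => hzn ?_
    obtain ⟨n, hn1, hn2⟩ := ENNReal.exists_mem_Ioc_zpow h0 htop (y := 2) (by norm_num) (by norm_num)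
    refine Set.mem_iUnion.2 ⟨n + 1, ?_, ?_⟩
    · push_cast
      rwa [add_sub_cancel_right, ENNReal.rpow_intCast]
    · rwa [ENNReal.rpow_intCast]
  have hset : MeasurableSet {z : ℝ × X | F z = 0 ∨
      superMass ν (fun x => ‖F (z.1, x)‖ₑ) z.2 ≠ 0 ∧
        superMass ν (fun x => ‖F (z.1, x)‖ₑ) z.2 ≠ ∞} :=
    (hF (measurableSet_singleton 0)).union
      ((hm (measurableSet_singleton 0).compl).inter (hm (measurableSet_singleton ∞).compl))
  rw [Measure.ae_prod_iff_ae_ae hset]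
  refine ae_of_all _ fun s => ?_
  have h0 : ∀ᵐ x ∂ν, superMass ν (fun x => ‖F (s, x)‖ₑ) x ≠ 0 := by
    rw [ae_iff]
    refine le_antisymm (le_trans (measure_mono fun x hx => ?_)
      (measure_superMass_le (ν := ν) (a := fun x => ‖F (s, x)‖ₑ) 0)) zero_le
    simpa using hx
  filter_upwards [h0] with x hx
  by_cases hFx : F (s, x) = 0
  · exact Or.inl hFx
  · refine Or.inr ⟨hx, ne_of_lt ?_⟩
    have := meas_ge_le_lintegral_div (hFs s).aestronglyMeasurable.enorm
      (ε := ‖F (s, x)‖ₑ) (by simpa using hFx) (by simp)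
    exact this.trans_lt (ENNReal.div_lt_top (hFs s).2.ne (by simpa using hFx))

lemma DispersiveFamily.hasSum_integral_layers [SFinite ν] (hk : DispersiveFamily ν σ A k)
    (hF : Measurable F) (hFi : Integrable F (volume.prod ν))
    (hFs : ∀ s, Integrable (fun x => F (s, x)) ν) :
    HasSum (fun n => ∫ s, ∫ x in massLayer ν (fun x => ‖F (s, x)‖ₑ) n, F (s, x) • k (s, x) ∂ν)
      (∫ z, F z • k z ∂(volume.prod ν)) := by
  have hG := hk.integrable_smul hFi
  have h := hasSum_integral_iUnion (fun n => measurableSet_spaceTimeLayer (ν := ν) hF n)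
    disjoint_spaceTimeLayer hG.integrableOn
  rw [setIntegral_eq_integral_of_ae_compl_eq_zero] at h
  · simpa only [integral_spaceTimeLayer hF hG] using h
  · filter_upwards [ae_mem_iUnion_spaceTimeLayer hF hFs] with z hz hzn
    rw [hz hzn, zero_smul]

lemma DispersiveFamily.dispersiveAtoms [SFinite ν] [CompleteSpace H]
    (hk : DispersiveFamily ν σ A k) (hp : 1 ≤ p)
    (hF : Measurable F) (hFi : Integrable F (volume.prod ν))
    (hFs : ∀ s, Integrable (fun x => F (s, x)) ν) :
    DispersiveAtoms σ (1 / p - 1 / 2) (1 - 1 / p) (4 * A)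
      (fun n s => layerNorm ν p (fun x => ‖F (s, x)‖ₑ) n)
      (fun n s => ∫ x in massLayer ν (fun x => ‖F (s, x)‖ₑ) n, F (s, x) • k (s, x) ∂ν) := by
  have hslice := fun s => (measurable_slice hF s).enorm
  have hlayer := fun s n => measurableSet_massLayer (ν := ν) (hslice s) n
  refine ⟨measurable_layerNorm_slice hF, fun n => ?_, fun n s => ?_, fun n m s t => ?_⟩
  · have hG := hk.integrable_smul hFi
    have := (hG.indicator (measurableSet_spaceTimeLayer (ν := ν) hF n)).integral_prod_left
    refine this.congr (ae_of_all _ fun s => ?_)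
    simp only
    rw [← integral_indicator (hlayer s n)]
    rfl
  · have h := hk.energy s _ ((hFs s).indicator (hlayer s n))
    have h1 : ∀ x, (massLayer ν (fun x => ‖F (s, x)‖ₑ) n).indicator (fun x => F (s, x)) x • k (s, x)
        = (massLayer ν (fun x => ‖F (s, x)‖ₑ) n).indicator (fun x => F (s, x) • k (s, x)) x :=
      fun x => (Set.indicator_smul_apply_left _ (fun x => F (s, x)) (fun x => k (s, x)) x).symm
    simp_rw [h1] at h
    rw [integral_indicator (hlayer s n)] at h
    have h2 : ∫⁻ x, ‖(massLayer ν (fun x => ‖F (s, x)‖ₑ) n).indicator (fun x => F (s, x)) x‖ₑ ^ 2 ∂ν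
        = ∫⁻ x in massLayer ν (fun x => ‖F (s, x)‖ₑ) n, ‖F (s, x)‖ₑ ^ 2 ∂ν := by
      rw [← lintegral_indicator (hlayer s n)]
      congr with x
      by_cases hx : x ∈ massLayer ν (fun x => ‖F (s, x)‖ₑ) n
      · simp [hx]
      · simp [hx]
    rw [h2] at h
    refine (ENNReal.pow_le_pow_left_iff two_ne_zero).1 (h.trans ?_)
    calc _ ≤ A ^ 2 * (4 * 2 ^ ((1 / 2 - 1 / p) * n) *
          layerNorm ν p (fun x => ‖F (s, x)‖ₑ) n) ^ 2 := by
          gcongr; exact lintegral_sq_massLayer_le (hslice s) hp n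
      _ = _ := by rw [neg_sub]; ring
  · refine (enorm_inner_integral_le _ _ _ _).trans ?_
    calc _ ≤ ∫⁻ x in massLayer ν (fun x => ‖F (s, x)‖ₑ) n,
          ∫⁻ y in massLayer ν (fun x => ‖F (t, x)‖ₑ) m,
            A ^ 2 * ENNReal.ofReal |s - t| ^ (-σ) * ‖F (s, x)‖ₑ * ‖F (t, y)‖ₑ ∂ν ∂ν := by
          gcongr with x y
          rw [inner_smul_left, inner_smul_right, enorm_mul, enorm_mul, RCLike.enorm_conj]
          calc _ = ‖inner ℂ (k (s, x)) (k (t, y))‖ₑ * ‖F (s, x)‖ₑ * ‖F (t, y)‖ₑ := by ring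
            _ ≤ _ := by gcongr; exact hk.dispersive s x t y
      _ = A ^ 2 * ENNReal.ofReal |s - t| ^ (-σ) *
          (∫⁻ x in massLayer ν (fun x => ‖F (s, x)‖ₑ) n, ‖F (s, x)‖ₑ ∂ν) *
          ∫⁻ y in massLayer ν (fun x => ‖F (t, x)‖ₑ) m, ‖F (t, y)‖ₑ ∂ν := by
          simp_rw [lintegral_const_mul _ (hslice t)]
          rw [lintegral_mul_const _ ((hslice s).const_mul _), lintegral_const_mul _ (hslice s)]
      _ ≤ A ^ 2 * ENNReal.ofReal |s - t| ^ (-σ) *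
          (4 * 2 ^ ((1 - 1 / p) * n) * layerNorm ν p (fun x => ‖F (s, x)‖ₑ) n) *
          (4 * 2 ^ ((1 - 1 / p) * m) * layerNorm ν p (fun x => ‖F (t, x)‖ₑ) m) := by
          gcongr
          · exact lintegral_massLayer_le (hslice s) hp n
          · exact lintegral_massLayer_le (hslice t) hp m
      _ = _ := by
          rw [mul_add (1 - 1 / p), ← ENNReal.two_rpow_mul]; ring

end Family

section DualEstimate

/-- The dual Strichartz estimate for dispersive families. -/
lemma DispersiveFamily.exists_enorm_integral_sq_le {σ q r p q' : ℝ} (hσ : 0 < σ) (hr : 2 < r)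
    (hq : 2 ≤ q) (hqr : 1 / q = σ * (1 / 2 - 1 / r)) (hcase : 2 < q ∨ q = 2 ∧ 3 / 2 ≤ σ)
    (hp : 1 / p = 1 - 1 / r) (hq' : 1 / q' = 1 - 1 / q) :
    ∃ C : ℝ≥0∞, C ≠ ∞ ∧ ∀ (X : Type*) [MeasurableSpace X] (ν : Measure X) [SFinite ν]
      (H : Type*) [NormedAddCommGroup H] [InnerProductSpace ℂ H] [CompleteSpace H]
      (A : ℝ≥0∞) (k : ℝ × X → H) (F : ℝ × X → ℂ),
      DispersiveFamily ν σ A k → Measurable F → Integrable F (volume.prod ν) →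
      (∀ s, Integrable (fun x => F (s, x)) ν) →
      ‖∫ z, F z • k z ∂(volume.prod ν)‖ₑ ^ 2
        ≤ C * A ^ 2 * (∫⁻ s, (∫⁻ x, ‖F (s, x)‖ₑ ^ p ∂ν) ^ (q' / p)) ^ (2 / q') := by
  have hr0 : 0 < 1 / r := by positivity
  have hr2 : 1 / r < 1 / 2 := one_div_lt_one_div_of_lt two_pos hr
  have hq2 : 1 / q ≤ 1 / 2 := one_div_le_one_div_of_le two_pos hq
  have hp0 : 0 < p := one_div_pos.1 (by rw [hp]; linarith)
  have hp1 : 1 ≤ p := by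
    rw [← one_div_one_div p, hp, one_le_div (by linarith)]; linarith
  have hp2 : p ≤ 2 := by
    rw [← one_div_one_div p, hp, div_le_iff₀ (by linarith)]; linarith
  have hq0 : 0 < q' := one_div_pos.1 (by rw [hq']; linarith)
  have hα : 0 < 1 / p - 1 / 2 := by rw [hp]; linarith
  have hβ : 0 < 1 - 1 / p := by rw [hp]; linarith
  rcases hcase with hq3 | ⟨rfl, hσ3⟩
  · have hq3' : 1 / q < 1 / 2 := one_div_lt_one_div_of_lt two_pos hq3
    obtain ⟨C, hC, hCle⟩ := exists_enorm_sq_le_of_dispersiveAtoms (γ := 2 * σ * (1 / p - 1 / 2))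
      (p := q') hσ hα hβ (by ring) rfl (by rw [hp]; linarith) (by
        have h : 2 * σ * (1 / p - 1 / 2) = 2 / q := by
          rw [hp]; linear_combination -2 * hqr
        rw [h, ← one_div_one_div q', hq', div_eq_div_iff (by linarith) (by
          have : 2 / q = 2 * (1 / q) := by ring
          linarith)]
        ring)
    refine ⟨C * 4 ^ 2 * (2 ^ q') ^ (2 / q'), by finiteness, ?_⟩
    intro X _ ν _ H _ _ _ A k F hk hF hFi hFs
    refine (hCle H _ _ _ _ (hk.dispersiveAtoms hp1 hF hFi hFs)
      (hk.hasSum_integral_layers hF hFi hFs)).trans ?_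
    have hN : Measurable fun s => (∫⁻ x, ‖F (s, x)‖ₑ ^ p ∂ν) ^ (q' / p) :=
      ((hF.enorm.pow_const p).lintegral_prod_right').pow_const _
    have hpt : ∀ s, ((∑' n, layerNorm ν p (fun x => ‖F (s, x)‖ₑ) n ^ 2) ^ (1 / 2 : ℝ)) ^ q'
        ≤ 2 ^ q' * (∫⁻ x, ‖F (s, x)‖ₑ ^ p ∂ν) ^ (q' / p) := by
      intro s
      calc _ ≤ ((4 * (∫⁻ x, ‖F (s, x)‖ₑ ^ p ∂ν) ^ (2 / p)) ^ (1 / 2 : ℝ)) ^ q' := by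
            gcongr
            exact tsum_layerNorm_sq_le (measurable_slice hF s).enorm hp1 hp2
        _ = _ := by
            rw [ENNReal.mul_rpow_of_nonneg _ _ (by norm_num), ENNReal.mul_rpow_of_nonneg _ _ hq0.le,
              show (4 : ℝ≥0∞) = 2 ^ (2 : ℝ) by norm_num, ← ENNReal.rpow_mul, ← ENNReal.rpow_mul,
              ← ENNReal.rpow_mul, ← ENNReal.rpow_mul]
            congr 2 <;> ring
    calc _ ≤ C * (4 * A) ^ 2 *
          (∫⁻ s, 2 ^ q' * (∫⁻ x, ‖F (s, x)‖ₑ ^ p ∂ν) ^ (q' / p)) ^ (2 / q') := by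
          gcongr with s; exact hpt s
      _ = _ := by
          rw [lintegral_const_mul _ hN, ENNReal.mul_rpow_of_nonneg _ _ (by positivity)]
          ring
  · obtain ⟨C, hC, hCle⟩ := exists_enorm_sq_le_of_dispersiveAtoms_endpoint (α := 1 / p - 1 / 2)
      (β := 1 - 1 / p) hσ3 (by rw [hp]; linear_combination -2 * hqr) (by ring)
    refine ⟨C * 4 ^ 2 * 4, by finiteness, ?_⟩
    intro X _ ν _ H _ _ _ A k F hk hF hFi hFs
    refine (hCle H _ _ _ _ (hk.dispersiveAtoms hp1 hF hFi hFs)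
      (hk.hasSum_integral_layers hF hFi hFs)).trans ?_
    have hq2 : q' = 2 := by
      rw [← one_div_one_div q', hq']; norm_num
    have hN : Measurable fun s => (∫⁻ x, ‖F (s, x)‖ₑ ^ p ∂ν) ^ (2 / p) :=
      ((hF.enorm.pow_const p).lintegral_prod_right').pow_const _
    subst hq2
    calc _ ≤ C * (4 * A) ^ 2 * ∫⁻ s, 4 * (∫⁻ x, ‖F (s, x)‖ₑ ^ p ∂ν) ^ (2 / p) := by
          gcongr with s
          exact tsum_layerNorm_sq_le (measurable_slice hF s).enorm hp1 hp2
      _ = _ := by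
          rw [lintegral_const_mul _ hN, div_self two_ne_zero, ENNReal.rpow_one]
          ring

end DualEstimate

section Duality

variable {X : Type*} [MeasurableSpace X] {ν : Measure X} {H : Type*} [NormedAddCommGroup H]
  [InnerProductSpace ℂ H] {σ q r p q' : ℝ} {A C : ℝ≥0∞} {k : ℝ × X → H}

lemma Real.rpow_le_add_rpow {a b x e : ℝ} (ha : 0 < a) (hax : a ≤ x) (hxb : x ≤ b) :
    x ^ e ≤ a ^ e + b ^ e := by
  have hx : 0 < x := ha.trans_le hax
  have hb : 0 < b := hx.trans_le hxb
  rcases le_total 0 e with he | he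
  · have := Real.rpow_le_rpow hx.le hxb he
    have := Real.rpow_nonneg ha.le e
    linarith
  · have := Real.rpow_le_rpow_of_nonpos ha hax he
    have := Real.rpow_nonneg hb.le e
    linarith

/-- The function that saturates Hölder's inequality in the mixed norm of `u`, restricted to
`T ×ˢ B`; here `g` is the spatial integral of `|u| ^ r`. -/
def mixedDual (T : Set ℝ) (B : Set X) (r e : ℝ) (u : ℝ × X → ℂ) (g : ℝ → ℝ≥0∞) :
    ℝ × X → ℂ :=
  (T ×ˢ B).indicator fun z => ((‖u z‖ ^ (r - 2) * (g z.1).toReal ^ e : ℝ) : ℂ) * u z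

variable {T : Set ℝ} {B : Set X} {u : ℝ × X → ℂ} {g : ℝ → ℝ≥0∞} {e U : ℝ} {m L : ℝ≥0∞}

lemma measurable_mixedDual (hT : MeasurableSet T) (hB : MeasurableSet B) (hu : Measurable u)
    (hg : Measurable g) : Measurable (mixedDual T B r e u g) := by
  refine Measurable.indicator ?_ (hT.prod hB)
  have : Measurable fun z : ℝ × X => (g z.1).toReal := (hg.comp measurable_fst).ennreal_toReal
  fun_prop

lemma exists_norm_mixedDual_le {X : Type*} {B : Set X} {u : ℝ × X → ℂ} (hr : 2 ≤ r)
    (hU : ∀ z, ‖u z‖ ≤ U) (hU0 : 0 ≤ U)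
    (hm : 0 < m) (hL : L ≠ ∞) (hgm : ∀ t ∈ T, m ≤ g t) (hgL : ∀ t, g t ≤ L) :
    ∃ K, ∀ z, ‖mixedDual T B r e u g z‖ ≤ K := by
  refine ⟨U ^ (r - 2) * (m.toReal ^ e + L.toReal ^ e) * U, fun z => ?_⟩
  have hpos : 0 ≤ U ^ (r - 2) * (m.toReal ^ e + L.toReal ^ e) * U := by positivity
  by_cases hz : z ∈ T ×ˢ B
  · rw [mixedDual, Set.indicator_of_mem hz, norm_mul, Complex.norm_real,
      Real.norm_of_nonneg (by positivity)]
    have hfin : g z.1 ≠ ∞ := ne_top_of_le_ne_top hL (hgL _)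
    have hmg := hgm z.1 hz.1
    gcongr
    · exact hU z
    · exact Real.rpow_le_add_rpow (ENNReal.toReal_pos hm.ne' (ne_top_of_le_ne_top hfin hmg))
        (ENNReal.toReal_mono hfin hmg) (ENNReal.toReal_mono hL (hgL _))
    · exact hU z
  · rwa [mixedDual, Set.indicator_of_notMem hz, norm_zero]

lemma enorm_mixedDual {X : Type*} {B : Set X} {u : ℝ × X → ℂ} (hr : 2 ≤ r)
    (hg0 : ∀ t ∈ T, g t ≠ 0) (hgL : ∀ t, g t ≠ ∞) (z : ℝ × X) :
    ‖mixedDual T B r e u g z‖ₑ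
      = T.indicator (fun t => g t ^ e) z.1 * B.indicator (fun x => ‖u (z.1, x)‖ₑ ^ (r - 1)) z.2 := by
  by_cases hz : z ∈ T ×ˢ B
  · rw [mixedDual, Set.indicator_of_mem hz, Set.indicator_of_mem hz.1, Set.indicator_of_mem hz.2,
      enorm_mul, ← ofReal_norm (E := ℂ) ((_ : ℝ) : ℂ), Complex.norm_real,
      Real.norm_of_nonneg (by positivity), ENNReal.ofReal_mul (by positivity),
      ← ENNReal.ofReal_rpow_of_nonneg (norm_nonneg _) (by linarith), ofReal_norm,
      ← ENNReal.ofReal_rpow_of_pos (ENNReal.toReal_pos (hg0 _ hz.1) (hgL _)),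
      ENNReal.ofReal_toReal (hgL _), show r - 1 = (r - 2) + 1 by ring,
      ENNReal.rpow_add_of_nonneg _ _ (by linarith) zero_le_one, ENNReal.rpow_one]
    ring
  · rw [mixedDual, Set.indicator_of_notMem hz, enorm_zero]
    by_cases hT : z.1 ∈ T
    · rw [Set.indicator_of_notMem (fun hB => hz ⟨hT, hB⟩) (s := B), mul_zero]
    · rw [Set.indicator_of_notMem hT, zero_mul]

lemma mixedDual_mul_conj {X : Type*} {B : Set X} {u : ℝ × X → ℂ} (z : ℝ × X) :
    mixedDual T B r e u g z * (starRingEnd ℂ) (u z)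
      = (‖mixedDual T B r e u g z * (starRingEnd ℂ) (u z)‖ : ℂ) := by
  by_cases hz : z ∈ T ×ˢ B
  · rw [mixedDual, Set.indicator_of_mem hz, mul_assoc, Complex.mul_conj, ← Complex.ofReal_mul,
      Complex.norm_real, Real.norm_of_nonneg]
    have := Complex.normSq_nonneg (u z)
    positivity
  · simp [mixedDual, Set.indicator_of_notMem hz]

lemma enorm_integral_of_eq_norm {Y : Type*} [MeasurableSpace Y] {μ : Measure Y} {f : Y → ℂ}
    (hf : Integrable f μ) (h : ∀ y, f y = (‖f y‖ : ℂ)) : ‖∫ y, f y ∂μ‖ₑ = ∫⁻ y, ‖f y‖ₑ ∂μ := by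
  rw [← ofReal_integral_norm_eq_lintegral_enorm hf, integral_congr_ae (ae_of_all _ h),
    integral_complex_ofReal, ← ofReal_norm, Complex.norm_real,
    Real.norm_of_nonneg (integral_nonneg fun _ => norm_nonneg _)]

lemma integrable_of_bounded_of_support {Y : Type*} [MeasurableSpace Y] {μ : Measure Y}
    {S : Set Y} {f : Y → ℂ} {K : ℝ} (hμ : μ S ≠ ∞) (hf : Measurable f)
    (hK : ∀ y, ‖f y‖ ≤ K) (hfS : ∀ y ∉ S, f y = 0) : Integrable f μ := by
  rw [← integrableOn_iff_integrable_of_support_subset (s := S)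
    (fun y hy => by_contra fun h => hy (hfS y h))]
  exact Measure.integrableOn_of_bounded hμ hf.aestronglyMeasurable (ae_of_all _ hK)

lemma DispersiveFamily.setLIntegral_rpow_le [SFinite ν] [CompleteSpace H]
    (hr : 2 ≤ r) (hq : 2 ≤ q) (hp : 1 / p = 1 - 1 / r) (hq' : 1 / q' = 1 - 1 / q)
    (hk : DispersiveFamily ν σ A k)
    (hC : ∀ F : ℝ × X → ℂ, Measurable F → Integrable F (volume.prod ν) →
      (∀ s, Integrable (fun x => F (s, x)) ν) →
      ‖∫ z, F z • k z ∂(volume.prod ν)‖ₑ ^ 2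
        ≤ C * A ^ 2 * (∫⁻ s, (∫⁻ x, ‖F (s, x)‖ₑ ^ p ∂ν) ^ (q' / p)) ^ (2 / q'))
    (h : H) (hT : MeasurableSet T) (hTfin : volume T ≠ ∞) (hB : MeasurableSet B)
    (hBfin : ν B ≠ ∞) (hm : 0 < m)
    (hTm : ∀ t ∈ T, m ≤ ∫⁻ x in B, ‖inner ℂ (k (t, x)) h‖ₑ ^ r ∂ν) :
    (∫⁻ t in T, (∫⁻ x in B, ‖inner ℂ (k (t, x)) h‖ₑ ^ r ∂ν) ^ (q / r)) ^ (2 / q)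
      ≤ C * A ^ 2 * ‖h‖ₑ ^ 2 := by
  set u : ℝ × X → ℂ := fun z => inner ℂ (k z) h
  set g : ℝ → ℝ≥0∞ := fun t => ∫⁻ x in B, ‖u (t, x)‖ₑ ^ r ∂ν
  set e := q / r - 1
  have hr0 : 0 < r := by linarith
  have hq0 : 0 < q := by linarith
  have hr1 : 1 / r ≤ 1 / 2 := one_div_le_one_div_of_le two_pos hr
  have hq1 : 1 / q ≤ 1 / 2 := one_div_le_one_div_of_le two_pos hq
  have hp0 : 0 < p := one_div_pos.1 (by rw [hp]; linarith)
  have hq0' : 0 < q' := one_div_pos.1 (by rw [hq']; linarith)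
  have hu : Measurable u := (hk.stronglyMeasurable.inner stronglyMeasurable_const).measurable
  have hg : Measurable g := (hu.enorm.pow_const r).lintegral_prod_right' (ν := ν.restrict B)
  obtain ⟨M, hM⟩ := hk.bounded
  have hU : ∀ z, ‖u z‖ ≤ max M 0 * ‖h‖ := fun z =>
    (norm_inner_le_norm _ _).trans (by gcongr; exact (hM z).trans (le_max_left _ _))
  set U := max M 0 * ‖h‖
  have hU0 : 0 ≤ U := by positivity
  set L : ℝ≥0∞ := ENNReal.ofReal U ^ r * ν B
  have hL : L ≠ ∞ := by finiteness
  have hgL : ∀ t, g t ≤ L := fun t => by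
    calc g t ≤ ∫⁻ x in B, ENNReal.ofReal U ^ r ∂ν := by
          refine lintegral_mono fun x => ?_
          gcongr
          rw [← ofReal_norm]
          exact ENNReal.ofReal_le_ofReal (hU _)
      _ = L := by rw [setLIntegral_const]
  have hgfin : ∀ t, g t ≠ ∞ := fun t => ne_top_of_le_ne_top hL (hgL t)
  have hg0 : ∀ t ∈ T, g t ≠ 0 := fun t ht => (hm.trans_le (hTm t ht)).ne'
  set F := mixedDual T B r e u g
  have hF : Measurable F := measurable_mixedDual hT hB hu hg
  obtain ⟨K, hK⟩ := exists_norm_mixedDual_le (T := T) (B := B) (e := e) hr hU hU0 hm hL hTm hgL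
  have hFi : Integrable F (volume.prod ν) := by
    refine integrable_of_bounded_of_support (S := T ×ˢ B) ?_ hF hK fun z hz =>
      Set.indicator_of_notMem hz _
    rw [Measure.prod_prod]; finiteness
  have hFs : ∀ s, Integrable (fun x => F (s, x)) ν := fun s =>
    integrable_of_bounded_of_support hBfin (measurable_slice hF s) (fun x => hK _) fun x hx =>
      Set.indicator_of_notMem (fun hz => hx hz.2) _
  have hFe : ∀ z, ‖F z‖ₑ = T.indicator (fun t => g t ^ e) z.1 *
      B.indicator (fun x => ‖u (z.1, x)‖ₑ ^ (r - 1)) z.2 := enorm_mixedDual hr hg0 hgfin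
  set Q := ∫⁻ t in T, g t ^ (q / r)
  have hdual : ∫⁻ s, (∫⁻ x, ‖F (s, x)‖ₑ ^ p ∂ν) ^ (q' / p) = Q := by
    simp only [Q]
    rw [← lintegral_indicator hT]
    congr with s
    by_cases hs : s ∈ T
    · have h1 : ∀ x, ‖F (s, x)‖ₑ ^ p = (g s ^ e) ^ p * B.indicator (fun x => ‖u (s, x)‖ₑ ^ r) x := by
        intro x
        rw [hFe, Set.indicator_of_mem hs, ENNReal.mul_rpow_of_nonneg _ _ hp0.le]
        by_cases hx : x ∈ B
        · rw [Set.indicator_of_mem hx, Set.indicator_of_mem hx, ← ENNReal.rpow_mul _ (r - 1)]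
          congr 2
          field_simp at hp
          linarith
        · rw [Set.indicator_of_notMem hx, Set.indicator_of_notMem hx, ENNReal.zero_rpow_of_pos hp0]
      have hus : Measurable fun x => B.indicator (fun x => ‖u (s, x)‖ₑ ^ r) x :=
        ((measurable_slice hu s).enorm.pow_const r).indicator hB
      simp_rw [h1]
      rw [lintegral_const_mul _ hus, lintegral_indicator hB, Set.indicator_of_mem hs]
      change ((g s ^ e) ^ p * g s) ^ (q' / p) = _
      conv_lhs => enter [1, 2]; rw [← ENNReal.rpow_one (g s)]
      rw [← ENNReal.rpow_mul, ← ENNReal.rpow_add _ _ (hg0 s hs) (hgfin s), ← ENNReal.rpow_mul]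
      congr 1
      simp only [e]
      have h1 : q = q' * (q - 1) := by
        field_simp at hq'
        linarith
      have h2 : p * (r - 1) = r := by
        field_simp at hp
        linarith
      calc ((q / r - 1) * p + 1) * (q' / p) = q' * (q / r - 1 + 1 / p) := by field_simp
        _ = q' * (q - 1) / r := by rw [hp]; field_simp; ring
        _ = q / r := by rw [← h1]
    · rw [Set.indicator_of_notMem hs]
      simp [hFe, Set.indicator_of_notMem hs, hp0, hq0']
  have hpair : Q ≤ ‖inner ℂ h (∫ z, F z • k z ∂(volume.prod ν))‖ₑ := by
    have hGi := hk.integrable_smul hFi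
    have hzu : ∀ z, inner ℂ h (F z • k z) = (‖inner ℂ h (F z • k z)‖ : ℂ) := by
      intro z
      rw [inner_smul_right, ← inner_conj_symm h (k z)]
      change F z * (starRingEnd ℂ) (u z) = ‖F z * (starRingEnd ℂ) (u z)‖
      exact mixedDual_mul_conj z
    rw [← integral_inner hGi, enorm_integral_of_eq_norm (hGi.const_inner h) hzu]
    have hpt : ∀ z, ‖inner ℂ h (F z • k z)‖ₑ
        = T.indicator (fun t => g t ^ e) z.1 * B.indicator (fun x => ‖u (z.1, x)‖ₑ ^ r) z.2 := by
      intro z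
      rw [inner_smul_right, enorm_mul, enorm_inner_comm, hFe]
      by_cases hz : z.2 ∈ B
      · rw [Set.indicator_of_mem hz, Set.indicator_of_mem hz, mul_assoc]
        congr 1
        change ‖u z‖ₑ ^ (r - 1) * ‖u z‖ₑ = ‖u z‖ₑ ^ r
        conv_lhs => enter [2]; rw [← ENNReal.rpow_one ‖u z‖ₑ]
        rw [← ENNReal.rpow_add_of_nonneg _ _ (by linarith) zero_le_one, sub_add_cancel]
      · rw [Set.indicator_of_notMem hz, Set.indicator_of_notMem hz]
        simp
    rw [lintegral_prod _ (hGi.const_inner h).aestronglyMeasurable.enorm]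
    simp only [hpt, Q]
    rw [← lintegral_indicator hT]
    refine (lintegral_congr fun t => ?_).le
    have hus : Measurable fun x => B.indicator (fun x => ‖u (t, x)‖ₑ ^ r) x :=
      ((measurable_slice hu t).enorm.pow_const r).indicator hB
    rw [lintegral_const_mul _ hus, lintegral_indicator hB]
    by_cases ht : t ∈ T
    · rw [Set.indicator_of_mem ht, Set.indicator_of_mem ht]
      change _ = g t ^ e * g t
      conv_rhs => enter [2]; rw [← ENNReal.rpow_one (g t)]
      rw [← ENNReal.rpow_add _ _ (hg0 t ht) (hgfin t), sub_add_cancel]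
    · rw [Set.indicator_of_notMem ht, Set.indicator_of_notMem ht, zero_mul]
  have hQfin : Q ≠ ∞ := by
    refine ne_top_of_le_ne_top (b := L ^ (q / r) * volume T) (by finiteness) ?_
    rw [← setLIntegral_const]
    refine lintegral_mono fun t => ?_
    gcongr
    exact hgL t
  have hmain : Q ^ 2 ≤ C * A ^ 2 * ‖h‖ₑ ^ 2 * Q ^ (2 / q') := by
    calc Q ^ 2 ≤ (‖h‖ₑ * ‖∫ z, F z • k z ∂(volume.prod ν)‖ₑ) ^ 2 := by
          gcongr; exact hpair.trans (enorm_inner_le_enorm _ _)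
      _ = ‖h‖ₑ ^ 2 * ‖∫ z, F z • k z ∂(volume.prod ν)‖ₑ ^ 2 := mul_pow _ _ _
      _ ≤ ‖h‖ₑ ^ 2 * (C * A ^ 2 * Q ^ (2 / q')) := by
          gcongr; rw [← hdual]; exact hC F hF hFi hFs
      _ = _ := by ring
  rcases eq_or_ne Q 0 with hQ0 | hQ0
  · rw [hQ0, ENNReal.zero_rpow_of_pos (by positivity)]; exact zero_le
  have hsplit : Q ^ 2 = Q ^ (2 / q) * Q ^ (2 / q') := by
    rw [← ENNReal.rpow_add _ _ hQ0 hQfin, ← ENNReal.rpow_natCast]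
    congr 1
    push_cast
    linear_combination -2 * hq'
  rw [hsplit] at hmain
  exact (ENNReal.mul_le_mul_iff_left (by simp [hQ0, hQfin]) (by finiteness)).1 hmain

end Duality

lemma lintegral_le_of_forall_le_of_tendsto {Y : Type*} [MeasurableSpace Y] {μ : Measure Y}
    {f : ℕ → Y → ℝ≥0∞} {F : Y → ℝ≥0∞} {D : ℝ≥0∞} (hf : ∀ n, AEMeasurable (f n) μ)
    (hlim : ∀ y, Tendsto (fun n => f n y) atTop (nhds (F y))) (hD : ∀ n, ∫⁻ y, f n y ∂μ ≤ D) :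
    ∫⁻ y, F y ∂μ ≤ D := by
  simp_rw [← fun y => (hlim y).liminf_eq]
  refine (lintegral_liminf_le' hf).trans (liminf_le_of_le (by isBoundedDefault) fun b hb => ?_)
  obtain ⟨n, hn⟩ := hb.exists
  exact hn.trans (hD n)

section Primal

variable {X : Type*} [MeasurableSpace X] {ν : Measure X} {H : Type*} [NormedAddCommGroup H]
  [InnerProductSpace ℂ H] {σ q r p q' : ℝ} {A C : ℝ≥0∞} {k : ℝ × X → H}

lemma tendsto_setLIntegral_spanningSets [SigmaFinite ν] {f : X → ℝ≥0∞} (hf : Measurable f) :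
    Tendsto (fun n => ∫⁻ x in spanningSets ν n, f x ∂ν) atTop (nhds (∫⁻ x, f x ∂ν)) := by
  refine Tendsto.congr (fun n => lintegral_indicator (measurableSet_spanningSets ν n) f) ?_
  refine lintegral_tendsto_of_tendsto_of_monotone
    (fun n => (hf.indicator (measurableSet_spanningSets ν n)).aemeasurable)
    (ae_of_all _ fun x m n hmn =>
      Set.indicator_le_indicator_of_subset (monotone_spanningSets ν hmn) (fun _ => zero_le) x)
    (ae_of_all _ fun x => ?_)
  refine tendsto_const_nhds.congr' ?_
  filter_upwards [eventually_ge_atTop (spanningSetsIndex ν x)] with n hn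
  exact (Set.indicator_of_mem (monotone_spanningSets ν hn (mem_spanningSetsIndex ν x)) f).symm

lemma DispersiveFamily.lintegral_rpow_le [SigmaFinite ν] [CompleteSpace H]
    (hr : 2 ≤ r) (hq : 2 ≤ q) (hp : 1 / p = 1 - 1 / r) (hq' : 1 / q' = 1 - 1 / q)
    (hk : DispersiveFamily ν σ A k)
    (hC : ∀ F : ℝ × X → ℂ, Measurable F → Integrable F (volume.prod ν) →
      (∀ s, Integrable (fun x => F (s, x)) ν) →
      ‖∫ z, F z • k z ∂(volume.prod ν)‖ₑ ^ 2
        ≤ C * A ^ 2 * (∫⁻ s, (∫⁻ x, ‖F (s, x)‖ₑ ^ p ∂ν) ^ (q' / p)) ^ (2 / q'))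
    (h : H) :
    (∫⁻ t, (∫⁻ x, ‖inner ℂ (k (t, x)) h‖ₑ ^ r ∂ν) ^ (q / r)) ^ (2 / q)
      ≤ C * A ^ 2 * ‖h‖ₑ ^ 2 := by
  have hr0 : 0 < r := by linarith
  have hq0 : 0 < q := by linarith
  have hu : Measurable fun z => inner ℂ (k z) h :=
    (hk.stronglyMeasurable.inner stronglyMeasurable_const).measurable
  have hur := hu.enorm.pow_const r
  set G : ℕ → ℝ → ℝ≥0∞ :=
    fun n t => ∫⁻ x in spanningSets ν n, ‖inner ℂ (k (t, x)) h‖ₑ ^ r ∂ν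
  have hG : ∀ n, Measurable (G n) := fun n => hur.lintegral_prod_right'
  have hlim : ∀ t, Tendsto (fun n => G n t) atTop
      (nhds (∫⁻ x, ‖inner ℂ (k (t, x)) h‖ₑ ^ r ∂ν)) := fun t =>
    tendsto_setLIntegral_spanningSets ((measurable_slice hu t).enorm.pow_const r)
  set T : ℕ → Set ℝ := fun n => Set.Icc (-n : ℝ) n ∩ {t | ((n : ℝ≥0∞) + 1)⁻¹ ≤ G n t}
  have hT : ∀ n, MeasurableSet (T n) := fun n =>
    measurableSet_Icc.inter (measurableSet_le measurable_const (hG n))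
  set D := (C * A ^ 2 * ‖h‖ₑ ^ 2) ^ (q / 2)
  suffices hD : ∫⁻ t, (∫⁻ x, ‖inner ℂ (k (t, x)) h‖ₑ ^ r ∂ν) ^ (q / r) ≤ D by
    calc _ ≤ D ^ (2 / q) := by gcongr
      _ = _ := by
        rw [← ENNReal.rpow_mul, show q / 2 * (2 / q) = 1 by field_simp, ENNReal.rpow_one]
  refine lintegral_le_of_forall_le_of_tendsto
    (f := fun n => (T n).indicator fun t => G n t ^ (q / r))
    (fun n => (((hG n).pow_const _).indicator (hT n)).aemeasurable) (fun t => ?_) fun n => ?_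
  · rcases eq_or_ne (∫⁻ x, ‖inner ℂ (k (t, x)) h‖ₑ ^ r ∂ν) 0 with h0 | h0
    · have hz : ∀ n, (T n).indicator (fun t => G n t ^ (q / r)) t = 0 := by
        intro n
        have : G n t = 0 := le_antisymm ((setLIntegral_le_lintegral _ _).trans h0.le) zero_le
        refine Set.indicator_apply_eq_zero.2 fun _ => ?_
        rw [this, ENNReal.zero_rpow_of_pos (by positivity)]
      simp_rw [hz, h0, ENNReal.zero_rpow_of_pos (show 0 < q / r by positivity)]
      exact tendsto_const_nhds
    · refine ((ENNReal.continuous_rpow_const.tendsto _).comp (hlim t)).congr' ?_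
      have hinv : Tendsto (fun n : ℕ => ((n : ℝ≥0∞) + 1)⁻¹) atTop (nhds 0) := by
        have := (tendsto_add_atTop_iff_nat 1).2 ENNReal.tendsto_inv_nat_nhds_zero
        simpa using this
      filter_upwards [hinv.eventually_lt (hlim t) (pos_iff_ne_zero.2 h0),
        tendsto_natCast_atTop_atTop.eventually_ge_atTop |t|] with n hn hnt
      exact (Set.indicator_of_mem (show t ∈ T n from ⟨abs_le.1 hnt, hn.le⟩)
        (fun t => G n t ^ (q / r))).symm
  · rw [lintegral_indicator (hT n)]
    have := hk.setLIntegral_rpow_le hr hq hp hq' hC h (hT n)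
      (measure_ne_top_of_subset Set.inter_subset_left (by simp))
      (measurableSet_spanningSets ν n) (measure_spanningSets_lt_top ν n).ne
      (m := ((n : ℝ≥0∞) + 1)⁻¹) (by simp) fun t ht => ht.2
    calc _ = ((∫⁻ t in T n, G n t ^ (q / r)) ^ (2 / q)) ^ (q / 2) := by
          rw [← ENNReal.rpow_mul, show 2 / q * (q / 2) = 1 by field_simp, ENNReal.rpow_one]
      _ ≤ D := ENNReal.rpow_le_rpow this (by positivity)

lemma enorm_inner_integral_mul_inner [CompleteSpace H] {Y : Type*} [MeasurableSpace Y]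
    {μ : Measure Y} {w : Y → H} {h : H} {c : Y → ℝ} (hc : ∀ y, 0 ≤ c y)
    (hi : Integrable (fun y => ((c y : ℂ) * inner ℂ (w y) h) • w y) μ) :
    ‖inner ℂ h (∫ y, ((c y : ℂ) * inner ℂ (w y) h) • w y ∂μ)‖ₑ
      = ∫⁻ y, ENNReal.ofReal (c y) * ‖inner ℂ (w y) h‖ₑ ^ 2 ∂μ := by
  have hz : ∀ y, inner ℂ h (((c y : ℂ) * inner ℂ (w y) h) • w y)
      = ((c y * ‖inner ℂ (w y) h‖ ^ 2 : ℝ) : ℂ) := by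
    intro y
    rw [inner_smul_right, ← inner_conj_symm h (w y), mul_assoc, Complex.mul_conj,
      Complex.normSq_eq_norm_sq]
    push_cast
    rfl
  have hn : ∀ y, ‖inner ℂ h (((c y : ℂ) * inner ℂ (w y) h) • w y)‖
      = c y * ‖inner ℂ (w y) h‖ ^ 2 := fun y => by
    rw [hz, Complex.norm_real, Real.norm_of_nonneg (mul_nonneg (hc y) (by positivity))]
  rw [← integral_inner hi, enorm_integral_of_eq_norm (hi.const_inner h)
    fun y => by rw [hn, hz]]
  congr with y
  rw [← ofReal_norm, hn, ENNReal.ofReal_mul (hc y), ENNReal.ofReal_pow (norm_nonneg _),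
    ofReal_norm]

lemma DispersiveFamily.lintegral_sq_le [SigmaFinite ν] [CompleteSpace H]
    (hk : DispersiveFamily ν σ A k) (h : H) (t : ℝ) :
    ∫⁻ x, ‖inner ℂ (k (t, x)) h‖ₑ ^ 2 ∂ν ≤ A ^ 2 * ‖h‖ₑ ^ 2 := by
  have hu : Measurable fun x => inner ℂ (k (t, x)) h :=
    measurable_slice (hk.stronglyMeasurable.inner stronglyMeasurable_const).measurable t
  have hks : StronglyMeasurable fun x => k (t, x) :=
    hk.stronglyMeasurable.comp_measurable measurable_prodMk_left
  obtain ⟨M, hM⟩ := hk.bounded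
  have hU : ∀ x, ‖inner ℂ (k (t, x)) h‖ ≤ M * ‖h‖ := fun x =>
    (norm_inner_le_norm _ _).trans (by gcongr; exact hM _)
  refine le_of_tendsto' (tendsto_setLIntegral_spanningSets (hu.enorm.pow_const 2)) fun n => ?_
  set B := spanningSets ν n
  have hB : MeasurableSet B := measurableSet_spanningSets ν n
  have hBfin : ν B ≠ ∞ := (measure_spanningSets_lt_top ν n).ne
  set c : X → ℝ := B.indicator fun _ => 1
  have hc : ∀ x, 0 ≤ c x := Set.indicator_nonneg fun _ _ => zero_le_one
  have hcB : ∀ x, (c x : ℂ) * inner ℂ (k (t, x)) h = B.indicator (fun x => inner ℂ (k (t, x)) h) x := by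
    intro x
    by_cases hx : x ∈ B <;> simp [c, hx]
  have hφ : Integrable (fun x => (c x : ℂ) * inner ℂ (k (t, x)) h) ν := by
    simp_rw [hcB]
    rw [integrable_indicator_iff hB]
    exact Measure.integrableOn_of_bounded hBfin hu.aestronglyMeasurable (ae_of_all _ hU)
  have hi : Integrable (fun x => ((c x : ℂ) * inner ℂ (k (t, x)) h) • k (t, x)) ν :=
    hφ.smul_bdd M hks.aestronglyMeasurable (ae_of_all _ fun x => hM _)
  have hpair := enorm_inner_integral_mul_inner (w := fun x => k (t, x)) hc hi
  have hen := hk.energy t _ hφ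
  have hQ1 : ∫⁻ x, ‖(c x : ℂ) * inner ℂ (k (t, x)) h‖ₑ ^ 2 ∂ν
      = ∫⁻ x in B, ‖inner ℂ (k (t, x)) h‖ₑ ^ 2 ∂ν := by
    rw [← lintegral_indicator hB]
    congr with x
    rw [hcB]
    by_cases hx : x ∈ B <;> simp [hx]
  have hQ2 : ∫⁻ x, ENNReal.ofReal (c x) * ‖inner ℂ (k (t, x)) h‖ₑ ^ 2 ∂ν
      = ∫⁻ x in B, ‖inner ℂ (k (t, x)) h‖ₑ ^ 2 ∂ν := by
    rw [← lintegral_indicator hB]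
    congr with x
    by_cases hx : x ∈ B <;> simp [c, hx]
  rw [hQ1] at hen
  rw [hQ2] at hpair
  set Q := ∫⁻ x in B, ‖inner ℂ (k (t, x)) h‖ₑ ^ 2 ∂ν
  have hQfin : Q ≠ ∞ := by
    refine ne_top_of_le_ne_top (b := ENNReal.ofReal (M * ‖h‖) ^ 2 * ν B) (by finiteness) ?_
    rw [← setLIntegral_const]
    refine lintegral_mono fun x => ?_
    rw [← ofReal_norm]
    gcongr
    exact hU x
  have hmain : Q * Q ≤ (A ^ 2 * ‖h‖ₑ ^ 2) * Q := by
    calc Q * Q = Q ^ 2 := (sq Q).symm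
      _ ≤ (‖h‖ₑ * ‖∫ x, ((c x : ℂ) * inner ℂ (k (t, x)) h) • k (t, x) ∂ν‖ₑ) ^ 2 := by
          gcongr; exact hpair.ge.trans (enorm_inner_le_enorm _ _)
      _ ≤ ‖h‖ₑ ^ 2 * (A ^ 2 * Q) := by rw [mul_pow]; gcongr
      _ = _ := by ring
  rcases eq_or_ne Q 0 with h0 | h0
  · rw [h0]; exact zero_le
  exact (ENNReal.mul_le_mul_iff_left h0 hQfin).1 hmain

lemma DispersiveFamily.lintegral_iSup_pow_four_le [CompleteSpace H]
    (hk : DispersiveFamily ν (1 / 2) A k) (h : H) (y : ℕ → X) :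
    ∫⁻ t, (⨆ i, ‖inner ℂ (k (t, y i)) h‖ₑ) ^ 4 ≤ 2 ^ 4 * (12 * A ^ 2 * ‖h‖ₑ ^ 2) ^ 2 := by
  have hu : Measurable fun z => inner ℂ (k z) h :=
    (hk.stronglyMeasurable.inner stronglyMeasurable_const).measurable
  obtain ⟨M, hM⟩ := hk.bounded
  have hU : ∀ z, ‖inner ℂ (k z) h‖ ≤ M * ‖h‖ := fun x =>
    (norm_inner_le_norm _ _).trans (by gcongr; exact hM _)
  set g : ℝ → ℝ≥0∞ := fun t => ⨆ i, ‖inner ℂ (k (t, y i)) h‖ₑ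
  have hui : ∀ i, Measurable fun t => ‖inner ℂ (k (t, y i)) h‖ₑ := fun i =>
    (hu.comp measurable_prodMk_right).enorm
  have hg : Measurable g := Measurable.iSup hui
  have hgU : ∀ t, g t ≤ ENNReal.ofReal (M * ‖h‖) := fun t => iSup_le fun i => by
    rw [← ofReal_norm]; exact ENNReal.ofReal_le_ofReal (hU _)
  have hex : ∀ t, ∃ i, g t ≤ 2 * ‖inner ℂ (k (t, y i)) h‖ₑ := by
    intro t
    by_contra! hcon
    have hle : g t ≤ g t / 2 := iSup_le fun i => by
      rw [ENNReal.le_div_iff_mul_le (by simp) (by simp), mul_comm]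
      exact (hcon i).le
    have h0 : g t ≠ 0 := (zero_le.trans_lt (hcon 0)).ne'
    exact absurd hle (ENNReal.half_lt_self h0
      (ne_top_of_le_ne_top ENNReal.ofReal_ne_top (hgU t))).not_ge
  classical
  set n : ℝ → ℕ := fun t => Nat.find (hex t)
  have hn : Measurable n :=
    measurable_find hex fun i => measurableSet_le hg ((hui i).const_mul 2)
  set w : ℝ → H := fun t => k (t, y (n t))
  have hw : StronglyMeasurable w :=
    hk.stronglyMeasurable.comp_measurable
      (measurable_id.prodMk ((measurable_from_nat (f := y)).comp hn))
  have hv : Measurable fun t => inner ℂ (w t) h :=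
    (hw.inner stronglyMeasurable_const).measurable
  set a : ℝ → ℝ≥0∞ := fun t => ‖inner ℂ (w t) h‖ₑ
  have ha : Measurable a := hv.enorm
  have hga : ∀ t, g t ≤ 2 * a t := fun t => Nat.find_spec (hex t)
  suffices hT : ∀ m : ℕ, ∫⁻ t in Set.Icc (-m : ℝ) m, a t ^ 4 ≤ (12 * A ^ 2 * ‖h‖ₑ ^ 2) ^ 2 by
    calc ∫⁻ t, g t ^ 4 ≤ ∫⁻ t, 2 ^ 4 * a t ^ 4 := by
          refine lintegral_mono fun t => ?_
          rw [← mul_pow]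
          gcongr
          exact hga t
      _ = 2 ^ 4 * ∫⁻ t, a t ^ 4 := lintegral_const_mul _ (ha.pow_const 4)
      _ ≤ _ := by
          gcongr
          refine lintegral_le_of_forall_le_of_tendsto
            (f := fun m : ℕ => (Set.Icc (-m : ℝ) m).indicator fun t => a t ^ 4)
            (fun m => ((ha.pow_const 4).indicator measurableSet_Icc).aemeasurable)
            (fun t => ?_) fun m => ?_
          · refine tendsto_const_nhds.congr' ?_
            filter_upwards [tendsto_natCast_atTop_atTop.eventually_ge_atTop |t|] with m hm
            exact (Set.indicator_of_mem (show t ∈ Set.Icc (-m : ℝ) m from abs_le.1 hm)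
              (fun t => a t ^ 4)).symm
          · rw [lintegral_indicator measurableSet_Icc]
            exact hT m
  intro m
  set T := Set.Icc (-m : ℝ) m
  have hTm : MeasurableSet T := measurableSet_Icc
  set c : ℝ → ℝ := T.indicator fun t => ‖inner ℂ (w t) h‖ ^ 2
  have hc : ∀ t, 0 ≤ c t := Set.indicator_nonneg fun _ _ => by positivity
  have hcm : Measurable c := (hv.norm.pow_const 2).indicator hTm
  set F : ℝ → ℂ := fun t => (c t : ℂ) * inner ℂ (w t) h
  have hFm : Measurable F := by fun_prop
  have hFe : ∀ t, ‖F t‖ₑ = T.indicator (fun t => a t ^ 3) t := by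
    intro t
    simp only [F, c]
    by_cases ht : t ∈ T
    · rw [Set.indicator_of_mem ht, Set.indicator_of_mem ht, enorm_mul, ← ofReal_norm,
        Complex.norm_real, norm_pow, norm_norm, ENNReal.ofReal_pow (norm_nonneg _), ofReal_norm]
      ring
    · simp [ht]
  have hFi : Integrable F := by
    refine integrable_of_bounded_of_support (S := T) (K := (M * ‖h‖) ^ 3) (by simp [T]) hFm
      (fun t => ?_) fun t ht => by simp [F, c, ht]
    have hMh : 0 ≤ M * ‖h‖ := (norm_nonneg _).trans (hU (t, y 0))
    by_cases ht : t ∈ T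
    · simp only [F, c, Set.indicator_of_mem ht, norm_mul, Complex.norm_real, norm_pow, norm_norm]
      rw [pow_succ (M * ‖h‖)]
      exact mul_le_mul (pow_le_pow_left₀ (norm_nonneg _) (hU _) 2) (hU _) (norm_nonneg _)
        (by positivity)
    · simp only [F, c, Set.indicator_of_notMem ht, Complex.ofReal_zero, zero_mul, norm_zero]
      positivity
  have hi : Integrable fun t => F t • w t :=
    hFi.smul_bdd M hw.aestronglyMeasurable (ae_of_all _ fun x => hM _)
  have hpair := enorm_inner_integral_mul_inner hc hi
  have hQ2 : ∫⁻ t, ENNReal.ofReal (c t) * ‖inner ℂ (w t) h‖ₑ ^ 2 = ∫⁻ t in T, a t ^ 4 := by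
    rw [← lintegral_indicator hTm]
    congr with t
    by_cases ht : t ∈ T
    · simp only [c, Set.indicator_of_mem ht, ENNReal.ofReal_pow (norm_nonneg _), ofReal_norm]
      ring
    · simp [c, ht]
  rw [hQ2] at hpair
  set Q := ∫⁻ t in T, a t ^ 4
  have hnorm : ‖∫ t, F t • w t‖ₑ ^ 2 ≤ 12 * A ^ 2 * Q ^ (3 / 2 : ℝ) := by
    rw [← enorm_inner_self]
    calc _ ≤ ∫⁻ s, ∫⁻ t, ‖inner ℂ (F s • w s) (F t • w t)‖ₑ := enorm_inner_integral_le _ _ _ _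
      _ ≤ ∫⁻ s, ∫⁻ t, A ^ 2 * (‖F s‖ₑ * ‖F t‖ₑ * ENNReal.ofReal |s - t| ^ (-(1 / 2) : ℝ)) := by
          gcongr with s t
          rw [inner_smul_left, inner_smul_right, enorm_mul, enorm_mul, RCLike.enorm_conj]
          calc _ = ‖inner ℂ (w s) (w t)‖ₑ * (‖F s‖ₑ * ‖F t‖ₑ) := by ring
            _ ≤ A ^ 2 * ENNReal.ofReal |s - t| ^ (-(1 / 2) : ℝ) * (‖F s‖ₑ * ‖F t‖ₑ) := by
                gcongr; exact hk.dispersive _ _ _ _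
            _ = _ := by ring
      _ = A ^ 2 * ∫⁻ s, ∫⁻ t, ‖F s‖ₑ * ‖F t‖ₑ * ENNReal.ofReal |s - t| ^ (-(1 / 2) : ℝ) := by
          have hmeas : Measurable fun z : ℝ × ℝ =>
              ‖F z.1‖ₑ * ‖F z.2‖ₑ * ENNReal.ofReal |z.1 - z.2| ^ (-(1 / 2) : ℝ) := by fun_prop
          rw [← lintegral_const_mul _ hmeas.lintegral_prod_right']
          congr with s
          have hslice : Measurable fun t =>
              ‖F s‖ₑ * ‖F t‖ₑ * ENNReal.ofReal |s - t| ^ (-(1 / 2) : ℝ) := by fun_prop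
          rw [lintegral_const_mul _ hslice]
      _ ≤ A ^ 2 * (2 * (ENNReal.ofReal (2 / (1 - 1 / 2)) + 2) *
            (∫⁻ t, ‖F t‖ₑ ^ (4 / 3 : ℝ)) ^ (2 / (4 / 3) : ℝ)) := by
          gcongr
          exact hardy_littlewood_sobolev (by norm_num) (by norm_num) (by norm_num) hFm.enorm
      _ = 12 * A ^ 2 * Q ^ (3 / 2 : ℝ) := by
          have h1 : ∫⁻ t, ‖F t‖ₑ ^ (4 / 3 : ℝ) = Q := by
            simp only [Q]
            rw [← lintegral_indicator hTm]
            congr with t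
            rw [hFe]
            by_cases ht : t ∈ T
            · rw [Set.indicator_of_mem ht, Set.indicator_of_mem ht, ← ENNReal.rpow_natCast,
                ← ENNReal.rpow_natCast, ← ENNReal.rpow_mul]
              norm_num
            · rw [Set.indicator_of_notMem ht, Set.indicator_of_notMem ht,
                ENNReal.zero_rpow_of_pos (by norm_num)]
          have h2 : ENNReal.ofReal (2 / (1 - 1 / 2)) = 4 := by norm_num
          rw [h1, h2, show (2 / (4 / 3) : ℝ) = 3 / 2 by norm_num]
          ring
  have hQfin : Q ≠ ∞ := by
    refine ne_top_of_le_ne_top (b := ENNReal.ofReal (M * ‖h‖) ^ 4 * volume T)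
      (ENNReal.mul_ne_top (by finiteness) (by simp [T])) ?_
    rw [← setLIntegral_const]
    refine lintegral_mono fun x => ?_
    simp only [a]
    rw [← ofReal_norm]
    gcongr
    exact hU _
  rcases eq_or_ne Q 0 with h0 | h0
  · rw [h0]; exact zero_le
  have hmain : Q ^ (1 / 2 : ℝ) * Q ^ (3 / 2 : ℝ) ≤ 12 * A ^ 2 * ‖h‖ₑ ^ 2 * Q ^ (3 / 2 : ℝ) := by
    calc _ = Q ^ 2 := by
          rw [← ENNReal.rpow_add _ _ h0 hQfin, ← ENNReal.rpow_natCast]; norm_num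
      _ ≤ (‖h‖ₑ * ‖∫ t, F t • w t‖ₑ) ^ 2 := by
          gcongr; exact hpair.ge.trans (enorm_inner_le_enorm _ _)
      _ ≤ ‖h‖ₑ ^ 2 * (12 * A ^ 2 * Q ^ (3 / 2 : ℝ)) := by rw [mul_pow]; gcongr
      _ = _ := by ring
  have hhalf := (ENNReal.mul_le_mul_iff_left (by simp [h0, hQfin]) (by finiteness)).1 hmain
  calc Q = (Q ^ (1 / 2 : ℝ)) ^ 2 := by
        rw [← ENNReal.rpow_natCast, ← ENNReal.rpow_mul]; norm_num
    _ ≤ _ := by gcongr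

end Primal

lemma Admissible.cases {d : ℕ} (hd : 1 ≤ d) {q r : ℝ≥0∞} (h : Admissible d q r) :
    (q = ∞ ∧ r = 2) ∨ (d = 1 ∧ q = 4 ∧ r = ∞) ∨
      (q ≠ ∞ ∧ r ≠ ∞ ∧ 2 < r.toReal ∧ 2 ≤ q.toReal ∧
        1 / q.toReal = (d / 2 : ℝ) * (1 / 2 - 1 / r.toReal) ∧
        (2 < q.toReal ∨ q.toReal = 2 ∧ 3 / 2 ≤ (d / 2 : ℝ))) := by
  obtain ⟨hq, hr, heq, hne⟩ := h
  have hdR : (1 : ℝ) ≤ d := by exact_mod_cast hd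
  rcases eq_or_ne q ∞ with rfl | hqt <;> rcases eq_or_ne r ∞ with rfl | hrt
  · have := congrArg ENNReal.toReal heq
    simp [ENNReal.toReal_div] at this
    linarith
  · left
    refine ⟨rfl, ?_⟩
    have := congrArg ENNReal.toReal heq
    have hr0 : 0 < r.toReal := ENNReal.toReal_pos (by positivity) hrt
    simp [ENNReal.toReal_div] at this
    rw [← ENNReal.ofReal_toReal hrt, show r.toReal = 2 by field_simp at this; linarith]
    simp
  · have hq2 := ENNReal.toReal_mono hqt hq
    have := congrArg ENNReal.toReal heq
    simp [ENNReal.toReal_div] at this hq2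
    field_simp at this
    have hd3 : (d : ℝ) ≤ 2 := by nlinarith
    have hd3 : d ≤ 2 := by exact_mod_cast hd3
    interval_cases d
    · right; left
      refine ⟨rfl, ?_, rfl⟩
      rw [← ENNReal.ofReal_toReal hqt, show q.toReal = 4 by norm_num at this; linarith]
      simp
    · refine absurd ⟨?_, rfl, rfl⟩ hne
      rw [← ENNReal.ofReal_toReal hqt, show q.toReal = 2 by norm_num at this; linarith]
      simp
  · right; right
    have hq2 := ENNReal.toReal_mono hqt hq
    have hr2 := ENNReal.toReal_mono hrt hr
    have hq0 : q ≠ 0 := by positivity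
    have hr0 : r ≠ 0 := by positivity
    have := congrArg ENNReal.toReal heq
    rw [ENNReal.toReal_add (ENNReal.div_ne_top (by simp) hq0)
      (ENNReal.div_ne_top (by simp) hr0)] at this
    simp [ENNReal.toReal_div] at this hq2 hr2
    set a := q.toReal
    set b := r.toReal
    have hab : 1 / a = (d / 2 : ℝ) * (1 / 2 - 1 / b) := by
      linear_combination this / 2
    have hb : 2 < b := by
      refine lt_of_le_of_ne hr2 fun hb => ?_
      rw [← hb] at hab
      have : 0 < 1 / a := by positivity
      norm_num at hab
      linarith
    refine ⟨hqt, hrt, hb, hq2, hab, ?_⟩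
    rcases hq2.lt_or_eq with h | h
    · exact Or.inl h
    · refine Or.inr ⟨h.symm, ?_⟩
      rw [← h] at hab
      have hb1 : 0 < 1 / b := by positivity
      have : (2 : ℝ) < d := by nlinarith
      have : (3 : ℝ) ≤ d := by exact_mod_cast (by exact_mod_cast this : 2 < d)
      linarith

lemma DispersiveFamily.exists_mixedNorm_le (d : ℕ) (hd : 1 ≤ d) {q r : ℝ≥0∞}
    (hadm : Admissible d q r) :
    ∃ C : ℝ≥0∞, C ≠ ∞ ∧ ∀ (H : Type) [NormedAddCommGroup H] [InnerProductSpace ℂ H]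
      [CompleteSpace H] (A : ℝ≥0∞) (k : ℝ × Ed d → H) (h : H),
      DispersiveFamily volume (d / 2) A k → (∀ t, Continuous fun x => k (t, x)) →
      ∃ G : ℝ → ℝ≥0∞, Measurable G ∧
        (∀ t, eLpNorm (fun x => inner ℂ (k (t, x)) h) r volume ≤ G t) ∧
        mixedNorm q Set.univ G ≤ C * (A * ‖h‖ₑ) := by
  rcases hadm.cases hd with ⟨rfl, rfl⟩ | ⟨rfl, rfl, rfl⟩ | ⟨hqt, hrt, hr2, hq2, hqr, hcase⟩
  · refine ⟨1, by simp, fun H _ _ _ A k h hk _ => ?_⟩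
    refine ⟨fun _ => A * ‖h‖ₑ, measurable_const, fun t => ?_, ?_⟩
    swap
    · rw [mixedNorm, if_pos rfl, one_mul]
      exact essSup_le_of_ae_le _ (ae_of_all _ fun t => le_rfl)
    rw [eLpNorm_eq_lintegral_rpow_enorm_toReal two_ne_zero ENNReal.ofNat_ne_top]
    simp only [ENNReal.toReal_ofNat, ENNReal.rpow_ofNat]
    calc _ ≤ (A ^ 2 * ‖h‖ₑ ^ 2) ^ (1 / 2 : ℝ) := by gcongr; exact hk.lintegral_sq_le h t
      _ = A * ‖h‖ₑ := by
        rw [← mul_pow, ← ENNReal.rpow_natCast, ← ENNReal.rpow_mul]; norm_num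
  · refine ⟨(2 ^ 4 * 12 ^ 2) ^ (1 / 4 : ℝ), by finiteness, fun H _ _ _ A k h hk hcont => ?_⟩
    have hu : Measurable fun z => inner ℂ (k z) h :=
      (hk.stronglyMeasurable.inner stronglyMeasurable_const).measurable
    have hsup : ∀ t, eLpNorm (fun x => inner ℂ (k (t, x)) h) ∞ volume
        ≤ ⨆ i, ‖inner ℂ (k (t, TopologicalSpace.denseSeq (Ed 1) i)) h‖ₑ := by
      intro t
      rw [eLpNorm_exponent_top]
      refine eLpNormEssSup_le_of_ae_enorm_bound (ae_of_all _ ?_)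
      have hc : Continuous fun x => ‖inner ℂ (k (t, x)) h‖ₑ :=
        continuous_enorm.comp ((hcont t).inner continuous_const)
      intro x
      refine (TopologicalSpace.denseRange_denseSeq (Ed 1)).induction_on x
        (isClosed_le hc continuous_const) fun i => ?_
      exact le_iSup (fun i => ‖inner ℂ (k (t, TopologicalSpace.denseSeq (Ed 1) i)) h‖ₑ) i
    refine ⟨_, Measurable.iSup fun i => (hu.comp measurable_prodMk_right).enorm, hsup, ?_⟩
    rw [mixedNorm, if_neg (by simp), Measure.restrict_univ]
    simp only [ENNReal.toReal_ofNat, ENNReal.rpow_ofNat]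
    have hk' : DispersiveFamily volume (1 / 2) A k := by simpa using hk
    calc _ ≤ (2 ^ 4 * (12 * A ^ 2 * ‖h‖ₑ ^ 2) ^ 2) ^ (1 / 4 : ℝ) := by
          gcongr
          exact hk'.lintegral_iSup_pow_four_le h (TopologicalSpace.denseSeq (Ed 1))
      _ = ((2 ^ 4 * 12 ^ 2) * (A * ‖h‖ₑ) ^ 4) ^ (1 / 4 : ℝ) := by congr 1; ring
      _ = _ := by
          rw [ENNReal.mul_rpow_of_nonneg _ _ (by norm_num), ← ENNReal.rpow_natCast (A * ‖h‖ₑ),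
            ← ENNReal.rpow_mul]
          norm_num
  · set a := q.toReal
    set b := r.toReal
    have hσ : (0 : ℝ) < d / 2 := by positivity
    have ha1 : 1 / a ≤ 1 / 2 := one_div_le_one_div_of_le two_pos hq2
    obtain ⟨C, hC, hdual⟩ := DispersiveFamily.exists_enorm_integral_sq_le hσ hr2 hq2 hqr hcase
      (p := 1 / (1 - 1 / b)) (q' := 1 / (1 - 1 / a)) (by simp) (by simp)
    refine ⟨C ^ (1 / 2 : ℝ), by finiteness, fun H _ _ _ A k h hk _ => ?_⟩
    have := hk.lintegral_rpow_le hr2.le hq2 (by simp) (by simp)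
      (fun F hF hFi hFs => hdual _ _ _ _ _ _ hk hF hFi hFs) h
    have hr0 : r ≠ 0 := by rintro rfl; simp [b] at hr2; linarith
    have hu : Measurable fun z => inner ℂ (k z) h :=
      (hk.stronglyMeasurable.inner stronglyMeasurable_const).measurable
    refine ⟨fun t => (∫⁻ x, ‖inner ℂ (k (t, x)) h‖ₑ ^ b) ^ (1 / b),
      (hu.enorm.pow_const b).lintegral_prod_right'.pow_const _,
      fun t => (eLpNorm_eq_lintegral_rpow_enorm_toReal hr0 hrt).le, ?_⟩
    rw [mixedNorm, if_neg hqt, Measure.restrict_univ]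
    simp_rw [← ENNReal.rpow_mul]
    change (∫⁻ t, (∫⁻ x, ‖inner ℂ (k (t, x)) h‖ₑ ^ b) ^ (1 / b * a)) ^ (1 / a) ≤ _
    rw [show 1 / b * a = a / b by ring]
    calc _ = ((∫⁻ t, (∫⁻ x, ‖inner ℂ (k (t, x)) h‖ₑ ^ b) ^ (a / b)) ^ (2 / a)) ^ (1 / 2 : ℝ) := by
          rw [← ENNReal.rpow_mul]; congr 1; ring
      _ ≤ (C * A ^ 2 * ‖h‖ₑ ^ 2) ^ (1 / 2 : ℝ) := by gcongr
      _ = (C * (A * ‖h‖ₑ) ^ 2) ^ (1 / 2 : ℝ) := by congr 1; ring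
      _ = _ := by
          rw [ENNReal.mul_rpow_of_nonneg _ _ (by norm_num), ← ENNReal.rpow_natCast (A * ‖h‖ₑ),
            ← ENNReal.rpow_mul]
          norm_num

section GaussianWave

/-- A plane wave evolved for time `z.1` from the point `z.2`, damped by a Gaussian in frequency. -/
def gaussianWave {d : ℕ} (ε : ℝ) (z : ℝ × Ed d) (ξ : Ed d) : ℂ :=
  cexp (-((ε / 2 : ℝ) - z.1 * I) * ‖ξ‖ ^ 2 + -I * ⟪z.2, ξ⟫)

/-- The correlation of two damped plane waves at the space-time separation `z`. -/
def gaussianCorrelation {d : ℕ} (ε : ℝ) (z : ℝ × Ed d) : ℂ :=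
  (Real.pi / (ε - z.1 * I)) ^ ((d / 2 : ℝ) : ℂ) * cexp (-(‖z.2‖ ^ 2 / (4 * (ε - z.1 * I))))

variable {d : ℕ} {ε : ℝ}

lemma inner_gaussianWave (z w : ℝ × Ed d) (ξ : Ed d) :
    inner ℂ (gaussianWave ε z ξ) (gaussianWave ε w ξ)
      = cexp (-(ε - (w.1 - z.1 : ℝ) * I) * ‖ξ‖ ^ 2 + -I * ⟪w.2 - z.2, ξ⟫) := by
  rw [RCLike.inner_apply, gaussianWave, gaussianWave, ← Complex.exp_conj, ← Complex.exp_add]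
  congr 1
  simp [inner_sub_left, map_ofNat (starRingEnd ℂ)]
  ring

lemma memLp_gaussianWave (hε : 0 < ε) (z : ℝ × Ed d) : MemLp (gaussianWave ε z) 2 := by
  have hc : Continuous (gaussianWave ε z) := by unfold gaussianWave; fun_prop
  rw [memLp_two_iff_integrable_sq_norm hc.aestronglyMeasurable]
  have := (GaussianFourier.integrable_cexp_neg_mul_sq_norm_add (V := Ed d) (b := ε)
    (by simpa using hε) 0 0).norm
  refine this.congr (ae_of_all _ fun ξ => ?_)
  simp only [gaussianWave, Complex.norm_exp, ← Real.exp_nat_mul]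
  congr 1
  simp [← Complex.ofReal_pow]
  ring

/-- The damped plane wave as a vector of `L²`. -/
def gaussianWaveLp (hε : 0 < ε) (z : ℝ × Ed d) : Lp ℂ 2 (volume : Measure (Ed d)) :=
  (memLp_gaussianWave hε z).toLp

lemma inner_gaussianWaveLp_eq_integral (hε : 0 < ε) (z w : ℝ × Ed d) :
    inner ℂ (gaussianWaveLp hε z) (gaussianWaveLp hε w)
      = ∫ ξ, cexp (-(ε - (w.1 - z.1 : ℝ) * I) * ‖ξ‖ ^ 2 + -I * ⟪w.2 - z.2, ξ⟫) := by
  rw [L2.inner_def]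
  refine integral_congr_ae ?_
  filter_upwards [(memLp_gaussianWave hε z).coeFn_toLp, (memLp_gaussianWave hε w).coeFn_toLp]
    with ξ h1 h2
  rw [gaussianWaveLp, gaussianWaveLp, h1, h2, inner_gaussianWave]

lemma inner_gaussianWaveLp (hε : 0 < ε) (z w : ℝ × Ed d) :
    inner ℂ (gaussianWaveLp hε z) (gaussianWaveLp hε w) = gaussianCorrelation ε (w - z) := by
  rw [inner_gaussianWaveLp_eq_integral,
    GaussianFourier.integral_cexp_neg_mul_sq_norm_add (by simpa using hε), gaussianCorrelation]
  simp only [Prod.fst_sub, Prod.snd_sub, finrank_euclideanSpace, Fintype.card_fin]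
  congr 2
  · push_cast; rfl
  · rw [neg_sq, Complex.I_sq]; ring

lemma sub_mul_I_ne_zero (hε : 0 < ε) (t : ℝ) : (ε - t * I : ℂ) ≠ 0 := fun h => by
  have := congrArg Complex.re h
  simp at this
  exact hε.ne' this

lemma continuous_gaussianCorrelation (hε : 0 < ε) :
    Continuous (gaussianCorrelation ε : ℝ × Ed d → ℂ) := by
  have hb : ∀ z : ℝ × Ed d, (ε - z.1 * I : ℂ) ≠ 0 := fun z => sub_mul_I_ne_zero hε z.1
  have hdiv : Continuous fun z : ℝ × Ed d => (Real.pi / (ε - z.1 * I) : ℂ) :=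
    continuous_const.div (by fun_prop) hb
  have hexp : Continuous fun z : ℝ × Ed d => cexp (-(‖z.2‖ ^ 2 / (4 * (ε - z.1 * I)))) :=
    Complex.continuous_exp.comp
      (Continuous.div (by fun_prop) (by fun_prop) fun z => mul_ne_zero (by norm_num) (hb z)).neg
  refine Continuous.mul (hdiv.cpow continuous_const fun z => Or.inl ?_) hexp
  rw [Complex.div_re]
  have : 0 < Complex.normSq (ε - z.1 * I) := Complex.normSq_pos.2 (hb z)
  simp
  positivity

lemma norm_gaussianCorrelation (z : ℝ × Ed d) :
    ‖gaussianCorrelation ε z‖ = (Real.pi / ‖(ε - z.1 * I : ℂ)‖) ^ (d / 2 : ℝ)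
      * Real.exp (-(ε * ‖z.2‖ ^ 2 / (4 * Complex.normSq (ε - z.1 * I)))) := by
  rw [gaussianCorrelation, norm_mul, Complex.norm_cpow_real, norm_div, Complex.norm_real,
    Real.norm_of_nonneg Real.pi_pos.le, Complex.norm_exp]
  congr 2
  rw [Complex.neg_re, Complex.div_re]
  simp [← Complex.ofReal_pow]
  ring

lemma enorm_gaussianCorrelation_le (hε : 0 < ε) (z : ℝ × Ed d) :
    ‖gaussianCorrelation ε z‖ₑ
      ≤ ENNReal.ofReal (Real.pi ^ (d / 2 : ℝ)) * ENNReal.ofReal |z.1| ^ (-(d / 2) : ℝ) := by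
  rcases eq_or_ne d 0 with rfl | hd
  · rw [← ofReal_norm, norm_gaussianCorrelation]
    have : 0 ≤ ε * ‖z.2‖ ^ 2 / (4 * Complex.normSq (ε - z.1 * I)) :=
      div_nonneg (by positivity) (mul_nonneg (by norm_num) (Complex.normSq_nonneg _))
    simpa using this
  rcases eq_or_ne z.1 0 with h0 | h0
  · rw [h0, abs_zero, ENNReal.ofReal_zero, ENNReal.zero_rpow_of_neg (by simp; positivity),
      ENNReal.mul_top (by simp; positivity)]
    exact le_top
  have ht : 0 < |z.1| := abs_pos.2 h0
  rw [← ofReal_norm, norm_gaussianCorrelation, ENNReal.ofReal_rpow_of_pos ht,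
    ← ENNReal.ofReal_mul (by positivity), Real.rpow_neg ht.le, ← div_eq_mul_inv,
    ← Real.div_rpow Real.pi_pos.le ht.le]
  refine ENNReal.ofReal_le_ofReal ((mul_le_of_le_one_right (by positivity) ?_).trans ?_)
  · have : 0 ≤ ε * ‖z.2‖ ^ 2 / (4 * Complex.normSq (ε - z.1 * I)) :=
      div_nonneg (by positivity) (mul_nonneg (by norm_num) (Complex.normSq_nonneg _))
    simpa using this
  · have : |z.1| ≤ ‖(ε - z.1 * I : ℂ)‖ := by
      simpa using Complex.abs_im_le_norm (ε - z.1 * I : ℂ)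
    gcongr

lemma lintegral_enorm_gaussianCorrelation (hε : 0 < ε) :
    ∫⁻ x : Ed d, ‖gaussianCorrelation ε (0, x)‖ₑ = ENNReal.ofReal ((2 * Real.pi) ^ d) := by
  have hb : 0 < 1 / (4 * ε) := by positivity
  have hint := GaussianFourier.integral_rexp_neg_mul_sq_norm (V := Ed d) hb
  have hi : Integrable fun x : Ed d => Real.exp (-(1 / (4 * ε)) * ‖x‖ ^ 2) :=
    .of_integral_ne_zero (by rw [hint]; positivity)
  have hn : ∀ x : Ed d, ‖gaussianCorrelation ε (0, x)‖
      = (Real.pi / ε) ^ (d / 2 : ℝ) * Real.exp (-(1 / (4 * ε)) * ‖x‖ ^ 2) := by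
    intro x
    rw [norm_gaussianCorrelation]
    simp only [Complex.ofReal_zero, zero_mul, sub_zero, Complex.norm_real,
      Real.norm_of_nonneg hε.le, Complex.normSq_ofReal]
    congr 2
    field_simp
  simp_rw [← ofReal_norm, hn]
  rw [← ofReal_integral_eq_lintegral_ofReal (hi.const_mul _) (ae_of_all _ fun _ => by positivity),
    integral_const_mul, hint, finrank_euclideanSpace, Fintype.card_fin,
    ← Real.mul_rpow (by positivity) (by positivity)]
  congr 1
  rw [show Real.pi / ε * (Real.pi / (1 / (4 * ε))) = (2 * Real.pi) ^ (2 : ℝ) by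
    rw [Real.rpow_two]; field_simp; ring, ← Real.rpow_mul (by positivity),
    show (2 : ℝ) * (d / 2) = d by ring, Real.rpow_natCast]

lemma continuous_of_inner_eq_sub {G H : Type*} [AddGroup G] [TopologicalSpace G]
    [IsTopologicalAddGroup G] [NormedAddCommGroup H] [InnerProductSpace ℂ H] {k : G → H}
    {κ : G → ℂ} (hκ : Continuous κ) (h : ∀ z w, inner ℂ (k z) (k w) = κ (w - z)) :
    Continuous k := by
  refine continuous_iff_continuousAt.2 fun z => ?_
  rw [ContinuousAt, tendsto_iff_norm_sub_tendsto_zero]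
  have hn : ∀ w, ‖k w - k z‖ = √(2 * (κ 0).re - 2 * (κ (z - w)).re) := by
    intro w
    have hw : ∀ w, ‖k w‖ ^ 2 = (κ 0).re := fun w => by
      rw [← sub_self w, ← h, norm_sq_eq_re_inner (𝕜 := ℂ)]
      rfl
    rw [← Real.sqrt_sq (norm_nonneg (k w - k z)), norm_sub_sq (𝕜 := ℂ), h, hw, hw]
    congr 1
    change _ - 2 * (κ _).re + _ = _
    ring
  have : Continuous fun w => √(2 * (κ 0).re - 2 * (κ (z - w)).re) := by fun_prop
  simp_rw [hn]
  have := this.tendsto z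
  simpa using this

lemma continuous_gaussianWaveLp (hε : 0 < ε) :
    Continuous (gaussianWaveLp hε : ℝ × Ed d → Lp ℂ 2 (volume : Measure (Ed d))) :=
  continuous_of_inner_eq_sub (continuous_gaussianCorrelation hε) (inner_gaussianWaveLp hε)

/-- A constant for the dispersive and energy estimates of damped plane waves that does not depend
on the damping. -/
def waveConstant (d : ℕ) : ℝ≥0∞ :=
  1 + ENNReal.ofReal (Real.pi ^ (d / 2 : ℝ)) + 2 * ENNReal.ofReal ((2 * Real.pi) ^ d)

lemma waveConstant_ne_top (d : ℕ) : waveConstant d ≠ ∞ := by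
  unfold waveConstant; finiteness

lemma waveConstant_le_sq (d : ℕ) : waveConstant d ≤ waveConstant d ^ 2 :=
  le_self_pow₀ (by rw [waveConstant, add_assoc]; exact le_self_add) two_ne_zero

lemma dispersiveFamily_gaussianWaveLp (hε : 0 < ε) :
    DispersiveFamily volume (d / 2) (waveConstant d)
      (gaussianWaveLp hε : ℝ × Ed d → Lp ℂ 2 (volume : Measure (Ed d))) where
  stronglyMeasurable := (continuous_gaussianWaveLp hε).stronglyMeasurable
  bounded := by
    refine ⟨√((gaussianCorrelation ε (0 : ℝ × Ed d)).re), fun z => Real.le_sqrt_of_sq_le ?_⟩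
    rw [← sub_self z, ← inner_gaussianWaveLp hε, norm_sq_eq_re_inner (𝕜 := ℂ)]
    rfl
  dispersive s x t y := by
    rw [inner_gaussianWaveLp, abs_sub_comm]
    refine (enorm_gaussianCorrelation_le hε _).trans ?_
    refine mul_le_mul' ((le_add_left le_rfl).trans (le_self_add.trans (waveConstant_le_sq d))) ?_
    exact le_rfl
  energy t φ hφ := by
    have hK : Measurable fun x : Ed d => ‖gaussianCorrelation ε (0, x)‖ₑ :=
      ((continuous_gaussianCorrelation hε).comp (by fun_prop)).measurable.enorm
    have hsym : ∀ x y : Ed d, gaussianCorrelation ε (0, y - x) = gaussianCorrelation ε (0, x - y) := by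
      intro x y
      simp only [gaussianCorrelation]
      rw [norm_sub_rev]
    rw [← enorm_inner_self]
    calc _ ≤ ∫⁻ x, ∫⁻ y, ‖inner ℂ (φ x • gaussianWaveLp hε (t, x))
            (φ y • gaussianWaveLp hε (t, y))‖ₑ := enorm_inner_integral_le _ _ _ _
      _ = ∫⁻ x, ∫⁻ y, ‖φ x‖ₑ * ‖φ y‖ₑ * ‖gaussianCorrelation ε (0, x - y)‖ₑ := by
          congr with x
          congr with y
          rw [inner_smul_left, inner_smul_right, enorm_mul, enorm_mul, RCLike.enorm_conj,
            inner_gaussianWaveLp, Prod.mk_sub_mk, sub_self, hsym, mul_assoc]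
      _ ≤ (∫⁻ z : Ed d, ‖gaussianCorrelation ε (0, z)‖ₑ)
            * ((∫⁻ x, ‖φ x‖ₑ ^ 2) + ∫⁻ x, ‖φ x‖ₑ ^ 2) :=
          lintegral_mul_mul_kernel_le volume hφ.aestronglyMeasurable.enorm
            hφ.aestronglyMeasurable.enorm hK
      _ = 2 * ENNReal.ofReal ((2 * Real.pi) ^ d) * ∫⁻ x, ‖φ x‖ₑ ^ 2 := by
          rw [lintegral_enorm_gaussianCorrelation hε, ← two_mul]; ring
      _ ≤ _ := by
          gcongr
          exact (le_add_left le_rfl).trans (waveConstant_le_sq d)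

end GaussianWave

section Propagator

variable {d : ℕ} {ε : ℝ}

/-- The frequency integrand of the Schrödinger propagator. -/
def schrodIntegrand (d : ℕ) (t : ℝ) (f : Ed d → ℂ) (x ξ : Ed d) : ℂ :=
  cexp (I * (⟪x, ξ⟫ : ℝ)) * (cexp (-I * t * (‖ξ‖ ^ 2 : ℝ)) * FT d f ξ)

lemma norm_schrodIntegrand (t : ℝ) (f : Ed d → ℂ) (x ξ : Ed d) :
    ‖schrodIntegrand d t f x ξ‖ = ‖FT d f ξ‖ := by
  simp [schrodIntegrand, Complex.norm_exp, -Complex.ofReal_pow]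

lemma integrable_FT (u : SchwartzMap (Ed d) ℂ) : Integrable (FT d u) := by
  have h : FT d u = fun ξ => FourierTransform.fourier u ((2 * Real.pi)⁻¹ • ξ) := by
    ext ξ
    rw [SchwartzMap.fourier_coe, Real.fourier_eq', FT]
    congr with x
    rw [smul_eq_mul, real_inner_smul_right]
    congr 2
    have := Real.pi_ne_zero
    push_cast
    field_simp
  rw [h]
  exact (FourierTransform.fourier u).integrable.comp_smul (by positivity)

lemma integrable_schrodIntegrand (t : ℝ) (u : SchwartzMap (Ed d) ℂ) (x : Ed d) :
    Integrable (schrodIntegrand d t u x) := by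
  have hFT := integrable_FT u
  refine hFT.mono ?_ (ae_of_all _ fun ξ => (norm_schrodIntegrand t u x ξ).le)
  exact (Continuous.aestronglyMeasurable (by fun_prop)).mul
    ((Continuous.aestronglyMeasurable (by fun_prop)).mul hFT.1)

lemma inner_gaussianWaveLp_integral (hε : 0 < ε) {f : Ed d → ℂ} (hf : Integrable f)
    (t : ℝ) (x : Ed d) :
    inner ℂ (gaussianWaveLp hε (t, x)) (∫ y, f y • gaussianWaveLp hε (0, y))
      = ∫ ξ, cexp (-ε * ‖ξ‖ ^ 2) * schrodIntegrand d t f x ξ := by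
  have hk := dispersiveFamily_gaussianWaveLp (d := d) hε
  obtain ⟨M, hM⟩ := hk.bounded
  have hi : Integrable fun y => f y • gaussianWaveLp hε ((0 : ℝ), y) :=
    hf.smul_bdd M ((continuous_gaussianWaveLp hε).comp (by fun_prop)).aestronglyMeasurable
      (ae_of_all _ fun y => hM _)
  have hE : ∀ y ξ : Ed d, f y * cexp (-(ε - (0 - t : ℝ) * I) * ‖ξ‖ ^ 2 + -I * ⟪y - x, ξ⟫)
      = cexp (-ε * ‖ξ‖ ^ 2) * (cexp (I * (⟪x, ξ⟫ : ℝ)) * cexp (-I * t * (‖ξ‖ ^ 2 : ℝ))) *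
        (cexp (-I * (⟪y, ξ⟫ : ℝ)) * f y) := by
    intro y ξ
    rw [← Complex.exp_add, ← Complex.exp_add, ← mul_assoc, ← Complex.exp_add, mul_comm]
    congr 2
    rw [inner_sub_left]
    push_cast
    ring
  have hprod : Integrable (Function.uncurry fun y ξ : Ed d =>
      f y * cexp (-(ε - (0 - t : ℝ) * I) * ‖ξ‖ ^ 2 + -I * ⟪y - x, ξ⟫)) (volume.prod volume) := by
    have hg := GaussianFourier.integrable_cexp_neg_mul_sq_norm_add (V := Ed d) (b := ε)
      (by simpa using hε) 0 0
    refine (hf.mul_prod hg).mono (hf.1.comp_fst.mul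
      (Continuous.aestronglyMeasurable (by fun_prop))) (ae_of_all _ fun z => ?_)
    simp [Function.uncurry, Complex.norm_exp, ← Complex.ofReal_pow]
  rw [← integral_inner hi]
  simp_rw [inner_smul_right, inner_gaussianWaveLp_eq_integral, ← integral_const_mul]
  rw [integral_integral_swap hprod]
  congr with ξ
  simp_rw [hE]
  rw [integral_const_mul, schrodIntegrand, FT]
  ring

lemma tendsto_integral_schrodIntegrand (t : ℝ) (u : SchwartzMap (Ed d) ℂ) (x : Ed d) :
    Tendsto (fun n : ℕ => ∫ ξ, cexp (-(1 / (n + 1) : ℝ) * ‖ξ‖ ^ 2) * schrodIntegrand d t u x ξ)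
      atTop (nhds (∫ ξ, schrodIntegrand d t u x ξ)) := by
  have hi := integrable_schrodIntegrand t u x
  refine tendsto_integral_of_dominated_convergence (fun ξ => ‖schrodIntegrand d t u x ξ‖)
    (fun n => (Continuous.aestronglyMeasurable (by fun_prop)).mul hi.1) hi.norm
    (fun n => ae_of_all _ fun ξ => ?_) (ae_of_all _ fun ξ => ?_)
  · rw [norm_mul]
    refine mul_le_of_le_one_left (norm_nonneg _) ?_
    rw [Complex.norm_exp, Real.exp_le_one_iff, ← Complex.ofReal_pow, ← Complex.ofReal_neg,
      ← Complex.ofReal_mul, Complex.ofReal_re, neg_mul, neg_nonpos]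
    positivity
  · have h : Tendsto (fun n : ℕ => ((1 / (n + 1) : ℝ) : ℂ)) atTop (nhds ((0 : ℝ) : ℂ)) :=
      (Complex.continuous_ofReal.tendsto _).comp tendsto_one_div_add_atTop_nhds_zero_nat
    have hexp := ((Complex.continuous_exp.tendsto _).comp (h.neg.mul_const (‖ξ‖ ^ 2 : ℂ)))
    simpa using hexp.mul_const (schrodIntegrand d t u x ξ)

lemma enorm_schrod_le (t : ℝ) (f : Ed d → ℂ) (x : Ed d) :
    ‖schrod d t f x‖ₑ ≤ ‖∫ ξ, schrodIntegrand d t f x ξ‖ₑ := by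
  rw [schrod, FTinv, enorm_mul]
  refine mul_le_of_le_one_left zero_le ?_
  have hpi : 1 ≤ (2 * Real.pi) ^ d := one_le_pow₀ (by linarith [Real.pi_gt_three])
  rw [← ofReal_norm, norm_inv, Complex.norm_real, Real.norm_of_nonneg (by positivity),
    ENNReal.ofReal_le_one]
  exact inv_le_one_of_one_le₀ hpi

lemma mixedNorm_le_of_le_liminf {q : ℝ≥0∞} (hq : 2 ≤ q) {g : ℝ → ℝ≥0∞} {G : ℕ → ℝ → ℝ≥0∞}
    {D : ℝ≥0∞} (hG : ∀ n, Measurable (G n)) (hg : ∀ t, g t ≤ liminf (fun n => G n t) atTop)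
    (hD : ∀ n, mixedNorm q Set.univ (G n) ≤ D) (I : Set ℝ) : mixedNorm q I g ≤ D := by
  have hlim : ∀ {a : ℕ → ℝ≥0∞}, (∀ n, a n ≤ D) → liminf a atTop ≤ D := fun ha =>
    liminf_le_of_le (by isBoundedDefault) fun b hb => by
      obtain ⟨n, hn⟩ := hb.exists
      exact hn.trans (ha n)
  by_cases hqt : q = ∞
  · simp only [mixedNorm, if_pos hqt, Measure.restrict_univ] at hD ⊢
    refine essSup_le_of_ae_le _ (ae_restrict_of_ae ?_)
    have : ∀ᵐ t, ∀ n, G n t ≤ D := ae_all_iff.2 fun n => by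
      filter_upwards [ae_le_essSup (f := G n) (μ := volume)] with t ht using ht.trans (hD n)
    filter_upwards [this] with t ht using (hg t).trans (hlim ht)
  · simp only [mixedNorm, if_neg hqt, Measure.restrict_univ] at hD ⊢
    have hq0 : 0 < q.toReal := ENNReal.toReal_pos (by positivity) hqt
    have hD' : ∀ n, ∫⁻ t, G n t ^ q.toReal ≤ D ^ q.toReal := fun n => by
      have := hD n
      rwa [one_div, ENNReal.rpow_inv_le_iff hq0] at this
    rw [one_div, ENNReal.rpow_inv_le_iff hq0]
    calc ∫⁻ t in I, g t ^ q.toReal ≤ ∫⁻ t, g t ^ q.toReal := setLIntegral_le_lintegral _ _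
      _ ≤ ∫⁻ t, liminf (fun n => G n t ^ q.toReal) atTop := by
          refine lintegral_mono fun t => ?_
          refine (ENNReal.rpow_le_rpow (hg t) hq0.le).trans ?_
          exact ((ENNReal.orderIsoRpow _ hq0).liminf_apply (u := fun n => G n t)).le
      _ ≤ liminf (fun n => ∫⁻ t, G n t ^ q.toReal) atTop :=
          lintegral_liminf_le fun n => (hG n).pow_const _
      _ ≤ D ^ q.toReal :=
          liminf_le_of_le (by isBoundedDefault) fun b hb => by
            obtain ⟨n, hn⟩ := hb.exists
            exact hn.trans (hD' n)

end Propagator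

/-- Homogeneous Strichartz estimate for the Schrödinger equation.
For `d ≥ 1` and an admissible pair `(q,r)` there is `C = C(d,q,r) > 0` such that, for every
interval `I ⊆ ℝ` and every Schwartz datum `u₀`,
`‖e^{itΔ}u₀‖_{L^q_I L^r} ≤ C ‖u₀‖_{L²}`. -/
theorem homogeneous_strichartz_schrodinger
    (d : ℕ) (hd : 1 ≤ d) (q r : ℝ≥0∞) (hadm : Admissible d q r) :
    ∃ C : ℝ, 0 < C ∧
      ∀ I : Set ℝ, I.OrdConnected →
        ∀ u₀ : SchwartzMap (Ed d) ℂ,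
          mixedNorm q I (fun t => eLpNorm (schrod d t (fun x => u₀ x)) r volume) ≤
            ENNReal.ofReal C * eLpNorm (fun x => u₀ x) 2 volume := by
  obtain ⟨C, hC, hmain⟩ := DispersiveFamily.exists_mixedNorm_le d hd hadm
  set B := C * (waveConstant d * waveConstant d)
  have hB : B ≠ ∞ := by
    have := waveConstant_ne_top d
    finiteness
  refine ⟨B.toReal + 1, by positivity, fun I _ u₀ => ?_⟩
  have hBC : B ≤ ENNReal.ofReal (B.toReal + 1) := by
    rw [← ENNReal.ofReal_toReal hB]
    exact ENNReal.ofReal_le_ofReal (by simp)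
  have hε : ∀ n : ℕ, (0 : ℝ) < 1 / (n + 1) := fun n => by positivity
  have hk := fun n => dispersiveFamily_gaussianWaveLp (d := d) (hε n)
  set h := fun n => ∫ y, u₀ y • gaussianWaveLp (hε n) ((0 : ℝ), y)
  have hh : ∀ n, ‖h n‖ₑ ≤ waveConstant d * eLpNorm (fun x => u₀ x) 2 volume := by
    intro n
    refine (ENNReal.pow_le_pow_left_iff two_ne_zero).1 (((hk n).energy 0 _ u₀.integrable).trans ?_)
    rw [mul_pow]
    gcongr
    rw [eLpNorm_eq_lintegral_rpow_enorm_toReal two_ne_zero ENNReal.ofNat_ne_top,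
      ← ENNReal.rpow_natCast, ← ENNReal.rpow_mul]
    simp
  choose G hGm hGle hGD using fun n => hmain _ _ _ (h n) (hk n)
    fun t => (continuous_gaussianWaveLp (hε n)).comp (by fun_prop)
  refine (mixedNorm_le_of_le_liminf hadm.1 hGm (fun t => ?_)
    (D := B * eLpNorm (fun x => u₀ x) 2 volume) (fun n => (hGD n).trans ?_) I).trans (by gcongr)
  · have hmeas : ∀ n, AEStronglyMeasurable
        (fun x => inner ℂ (gaussianWaveLp (hε n) (t, x)) (h n)) volume := fun n =>
      (((continuous_gaussianWaveLp (hε n)).comp (by fun_prop)).inner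
        continuous_const).aestronglyMeasurable
    calc eLpNorm (schrod d t fun x => u₀ x) r volume
        ≤ eLpNorm (fun x => ∫ ξ, schrodIntegrand d t u₀ x ξ) r volume :=
          eLpNorm_mono_enorm fun x => enorm_schrod_le t _ x
      _ ≤ liminf (fun n => eLpNorm (fun x => inner ℂ (gaussianWaveLp (hε n) (t, x)) (h n))
            r volume) atTop := by
          refine Lp.eLpNorm_lim_le_liminf_eLpNorm hmeas _ (ae_of_all _ fun x => ?_)
          simp only [h, inner_gaussianWaveLp_integral (hε _) u₀.integrable]
          exact tendsto_integral_schrodIntegrand t u₀ x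
      _ ≤ _ := liminf_le_liminf (Eventually.of_forall fun n => hGle n t)
  · calc C * (waveConstant d * ‖h n‖ₑ)
        ≤ C * (waveConstant d * (waveConstant d * eLpNorm (fun x => u₀ x) 2 volume)) := by
          gcongr; exact hh n
      _ = _ := by ring
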